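/- arXiv:2507.11888 — 2 statements merged into one kernel-verified Lean document; each statement's English description precedes it below -/
import Mathlib

section
/- The Waldschmidt constant of the F4 configuration equals 8/3; that is, the infimum over all integers m ≥ 1 of α(I(F4)^{(m)})/m, where α(I(F4)^{(m)}) is the least degree of a nonzero homogeneous polynomial in ℂ[x,y,z,w] vanishing to order at least m at every point of the F4 configuration, equals 8/3. -/
open MvPolynomial

/-- A polynomial `F` vanishes to order at least `m` at a point with representative
vector `v` if all partial derivatives of `F` of total order less than `m` vanish at `v`. -/
def vanishesToOrder (F : MvPolynomial (Fin 4) ℂ) (v : Fin 4 → ℂ) (m : ℕ) : Prop :=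
  ∀ l : List (Fin 4), l.length < m →
    eval v (l.foldl (fun G i => pderiv i G) F) = 0

/-- The least degree of a nonzero homogeneous polynomial vanishing to order at least `m`
at every point of the configuration `Z`. -/
noncomputable def alphaSymbolic (Z : Set (Fin 4 → ℂ)) (m : ℕ) : ℕ :=
  sInf { d | ∃ F : MvPolynomial (Fin 4) ℂ, F ≠ 0 ∧ F.IsHomogeneous d ∧
    ∀ v ∈ Z, vanishesToOrder F v m }

/-- The 24 points of the F4 configuration, given by representative vectors. -/
def F4Pts : Fin 24 → (Fin 4 → ℂ) :=
  ![![1, 1, 0, 0], ![1, -1, 0, 0], ![1, 0, 1, 0], ![1, 0, -1, 0],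
    ![1, 0, 0, 1], ![1, 0, 0, -1], ![0, 1, 1, 0], ![0, 1, -1, 0],
    ![0, 1, 0, 1], ![0, 1, 0, -1], ![0, 0, 1, 1], ![0, 0, 1, -1],
    ![1, 0, 0, 0], ![0, 1, 0, 0], ![0, 0, 1, 0], ![0, 0, 0, 1],
    ![1, 1, 1, 1], ![1, 1, -1, -1], ![1, -1, 1, -1], ![1, -1, -1, 1],
    ![-1, 1, 1, 1], ![1, -1, 1, 1], ![1, 1, -1, 1], ![1, 1, 1, -1]]

/-- The F4 configuration as a set of points. -/
def F4Config : Set (Fin 4 → ℂ) := Set.range F4Pts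




lemma hasDerivAt_line (F : MvPolynomial (Fin 4) ℂ) (v h : Fin 4 → ℂ) (s : ℂ) :
    HasDerivAt (fun s : ℂ => eval (v + s • h) F)
      (∑ i, h i * eval (v + s • h) (pderiv i F)) s := by
  induction F using MvPolynomial.induction_on with
  | C a => simpa using hasDerivAt_const s a
  | add p q hp hq =>
    have e1 : (fun s : ℂ => eval (v + s • h) (p + q))
        = (fun s : ℂ => eval (v + s • h) p) + (fun s : ℂ => eval (v + s • h) q) := by
      funext s; simp
    have e2 : (∑ i, h i * eval (v + s • h) (pderiv i (p + q)))
        = (∑ i, h i * eval (v + s • h) (pderiv i p))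
          + (∑ i, h i * eval (v + s • h) (pderiv i q)) := by
      simp [mul_add, Finset.sum_add_distrib]
    rw [e1, e2]
    exact hp.add hq
  | mul_X p j hp =>
    have h1 : HasDerivAt (fun s : ℂ => v j + s * h j) (h j) s := by
      simpa using ((hasDerivAt_id s).mul_const (h j)).const_add (v j)
    have h2 := hp.mul h1
    have e1 : (fun s : ℂ => eval (v + s • h) (p * X j))
        = (fun s : ℂ => eval (v + s • h) p) * (fun s : ℂ => v j + s * h j) := by
      funext s; simp
    have e2 : (∑ i, h i * eval (v + s • h) (pderiv i (p * X j)))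
        = (∑ i, h i * eval (v + s • h) (pderiv i p)) * (v j + s * h j)
          + eval (v + s • h) p * h j := by
      have e3 : ∀ i, h i * eval (v + s • h) (pderiv i (p * X j))
          = h i * eval (v + s • h) (pderiv i p) * (v j + s * h j)
            + if i = j then eval (v + s • h) p * h j else 0 := by
        intro i
        rw [Derivation.leibniz, pderiv_X]
        by_cases hij : i = j
        · subst hij; simp; ring
        · simp [hij]; ring
      rw [Finset.sum_congr rfl fun i _ => e3 i, Finset.sum_add_distrib, Finset.sum_mul]
      simp
    rw [e1, e2]
    exact h2

lemma vanish_bound (R : ℝ) (m : ℕ) : ∀ (F : MvPolynomial (Fin 4) ℂ) (v : Fin 4 → ℂ),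
    vanishesToOrder F v m →
    ∃ C : ℝ, 0 ≤ C ∧ ∀ h : Fin 4 → ℂ, ‖h‖ ≤ R → ‖eval (v + h) F‖ ≤ C * ‖h‖ ^ m := by
  induction m with
  | zero =>
    intro F v _
    have hc : Continuous fun h : Fin 4 → ℂ => eval (v + h) F :=
      (MvPolynomial.continuous_eval F).comp (continuous_const.add continuous_id)
    obtain ⟨C, hC⟩ := (isCompact_closedBall (0 : Fin 4 → ℂ) R).exists_bound_of_continuousOn
      hc.continuousOn
    refine ⟨max C 0, le_max_right _ _, fun h hh => ?_⟩
    have := hC h (by simpa using hh)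
    simpa using Or.inl this
  | succ m ih =>
    intro F v hF
    have hd : ∀ i, vanishesToOrder (pderiv i F) v m := by
      intro i l hl
      have := hF (i :: l) (by simpa using hl)
      simpa using this
    choose C hC0 hC using fun i => ih (pderiv i F) v (hd i)
    refine ⟨∑ i, C i, Finset.sum_nonneg fun i _ => hC0 i, fun h hh => ?_⟩
    have hF0 : eval v F = 0 := by simpa using hF [] (by simp)
    have key := (convex_closedBall (0 : ℂ) 1).norm_image_sub_le_of_norm_hasDerivWithin_le
      (f := fun s : ℂ => eval (v + s • h) F)
      (f' := fun s => ∑ i, h i * eval (v + s • h) (pderiv i F))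
      (C := (∑ i, C i) * ‖h‖ ^ (m + 1)) (x := 0) (y := 1)
      (fun s _ => (hasDerivAt_line F v h s).hasDerivWithinAt) ?_ (by simp) (by simp)
    · simpa [hF0] using key
    · intro s hs
      have hs1 : ‖s‖ ≤ 1 := by simpa using hs
      have hsh : ‖s • h‖ ≤ ‖h‖ := by
        rw [norm_smul]; nlinarith [norm_nonneg h]
      calc ‖∑ i, h i * eval (v + s • h) (pderiv i F)‖
          ≤ ∑ i, ‖h i * eval (v + s • h) (pderiv i F)‖ := norm_sum_le _ _
        _ ≤ ∑ i, C i * ‖h‖ ^ (m + 1) := by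
            refine Finset.sum_le_sum fun i _ => ?_
            rw [norm_mul, pow_succ, ← mul_assoc, mul_comm]
            refine mul_le_mul ?_ (norm_le_pi_norm h i) (norm_nonneg _)
              (mul_nonneg (hC0 i) (by positivity))
            exact (hC i _ (hsh.trans hh)).trans
              (mul_le_mul_of_nonneg_left (pow_le_pow_left₀ (norm_nonneg _) hsh m) (hC0 i))
        _ = _ := by rw [Finset.sum_mul]



lemma homog_smul {F : MvPolynomial (Fin 4) ℂ} {d : ℕ} (hF : F.IsHomogeneous d) (c : ℂ)
    (x : Fin 4 → ℂ) : eval (c • x) F = c ^ d * eval x F := by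
  rw [eval_eq, eval_eq, Finset.mul_sum]
  refine Finset.sum_congr rfl fun s hs => ?_
  have h1 : s.degree = d := by
    have := hF (mem_support_iff.mp hs)
    rwa [Finsupp.degree_eq_weight_one]
  have h2 : ∏ i, c ^ s i = c ^ d := by
    rw [Finset.prod_pow_eq_pow_sum, ← h1, Finsupp.degree_eq_sum]
  simp only [Pi.smul_apply, smul_eq_mul, mul_pow, Finset.prod_mul_distrib] at *
  have h3 : ∏ i ∈ s.support, c ^ s i = c ^ d := by
    rw [← h2]
    refine Finset.prod_subset (Finset.subset_univ _) fun i _ hi => ?_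
    simp [Finsupp.notMem_support_iff.mp hi]
  rw [h3]; ring

/-- signed permutation action -/
def sact (σ : Equiv.Perm (Fin 4)) (ε : Fin 4 → ℤˣ) (x : Fin 4 → ℂ) : Fin 4 → ℂ :=
  fun i => ((ε i : ℤ) : ℂ) * x (σ i)

lemma sact_add (σ : Equiv.Perm (Fin 4)) (ε : Fin 4 → ℤˣ) (x y : Fin 4 → ℂ) :
    sact σ ε (x + y) = sact σ ε x + sact σ ε y := by
  funext i; simp [sact, mul_add]

lemma sact_smul (σ : Equiv.Perm (Fin 4)) (ε : Fin 4 → ℤˣ) (c : ℂ) (x : Fin 4 → ℂ) :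
    sact σ ε (c • x) = c • sact σ ε x := by
  funext i; simp [sact]; ring

lemma sact_norm (σ : Equiv.Perm (Fin 4)) (ε : Fin 4 → ℤˣ) (x : Fin 4 → ℂ) :
    ‖sact σ ε x‖ ≤ ‖x‖ := by
  refine (pi_norm_le_iff_of_nonneg (norm_nonneg _)).mpr fun i => ?_
  rcases Int.units_eq_one_or (ε i) with h | h <;> simp [sact, h, norm_le_pi_norm x (σ i)]

/-- vectors representing points of the configuration up to sign -/
def GoodVec (v : Fin 4 → ℂ) : Prop :=
  ∃ u : Fin 4 → SignType, (∀ i, v i = ((u i : ℤ) : ℂ)) ∧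
    ((Finset.univ.filter fun i => u i ≠ 0).card = 1 ∨
     (Finset.univ.filter fun i => u i ≠ 0).card = 2 ∨
     (Finset.univ.filter fun i => u i ≠ 0).card = 4)

lemma GoodVec.sact {v : Fin 4 → ℂ} (hv : GoodVec v) (σ : Equiv.Perm (Fin 4)) (ε : Fin 4 → ℤˣ) :
    GoodVec (sact σ ε v) := by
  obtain ⟨u, hu, hc⟩ := hv
  refine ⟨fun i => SignType.sign (ε i : ℤ) * u (σ i), fun i => ?_, ?_⟩
  · rcases Int.units_eq_one_or (ε i) with h | h <;> simp [_root_.sact, h, hu]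
  · have : (Finset.univ.filter fun i => SignType.sign (ε i : ℤ) * u (σ i) ≠ 0).card
        = (Finset.univ.filter fun i => u i ≠ 0).card := by
      refine Finset.card_bij (fun i _ => σ i) ?_ ?_ ?_
      · intro i hi
        simp only [Finset.mem_filter, Finset.mem_univ, true_and] at hi ⊢
        exact right_ne_zero_of_mul hi
      · intro i _ j _ h; exact σ.injective h
      · intro j hj
        refine ⟨σ.symm j, ?_, by simp⟩
        simp only [Finset.mem_filter, Finset.mem_univ, true_and, Equiv.apply_symm_apply] at hj ⊢
        rcases Int.units_eq_one_or (ε (σ.symm j)) with h | h <;> simp [h, hj]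
    rw [this]; exact hc

/-- integer version of the points -/
def F4Z : Fin 24 → (Fin 4 → ℤ) :=
  ![![1, 1, 0, 0], ![1, -1, 0, 0], ![1, 0, 1, 0], ![1, 0, -1, 0],
    ![1, 0, 0, 1], ![1, 0, 0, -1], ![0, 1, 1, 0], ![0, 1, -1, 0],
    ![0, 1, 0, 1], ![0, 1, 0, -1], ![0, 0, 1, 1], ![0, 0, 1, -1],
    ![1, 0, 0, 0], ![0, 1, 0, 0], ![0, 0, 1, 0], ![0, 0, 0, 1],
    ![1, 1, 1, 1], ![1, 1, -1, -1], ![1, -1, 1, -1], ![1, -1, -1, 1],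
    ![-1, 1, 1, 1], ![1, -1, 1, 1], ![1, 1, -1, 1], ![1, 1, 1, -1]]

lemma F4Pts_eq (j : Fin 24) (i : Fin 4) : F4Pts j i = ((F4Z j i : ℤ) : ℂ) := by
  fin_cases j <;> fin_cases i <;> simp [F4Pts, F4Z]

set_option maxRecDepth 100000 in
lemma sign_dec : ∀ a b c d : SignType,
    ((Finset.univ.filter fun i => (![a, b, c, d] : Fin 4 → SignType) i ≠ 0).card = 1 ∨
     (Finset.univ.filter fun i => (![a, b, c, d] : Fin 4 → SignType) i ≠ 0).card = 2 ∨
     (Finset.univ.filter fun i => (![a, b, c, d] : Fin 4 → SignType) i ≠ 0).card = 4) →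
    ∃ j : Fin 24, (∀ i, ((![a, b, c, d] : Fin 4 → SignType) i : ℤ) = F4Z j i) ∨
      (∀ i, ((![a, b, c, d] : Fin 4 → SignType) i : ℤ) = -F4Z j i) := by
  decide

lemma GoodVec.exists_pt {v : Fin 4 → ℂ} (hv : GoodVec v) :
    ∃ j, v = F4Pts j ∨ v = -F4Pts j := by
  obtain ⟨u, hu, hc⟩ := hv
  have hu4 : u = ![u 0, u 1, u 2, u 3] := by
    funext i; fin_cases i <;> rfl
  rw [hu4] at hc
  obtain ⟨j, h⟩ := sign_dec _ _ _ _ hc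
  rw [← hu4] at h
  refine ⟨j, h.imp (fun h => ?_) fun h => ?_⟩
  · funext i; rw [hu, h, F4Pts_eq]
  · funext i; rw [hu, h, Pi.neg_apply, F4Pts_eq]; simp

/-- symmetrised norm of `F` -/
noncomputable def NF (F : MvPolynomial (Fin 4) ℂ) (x : Fin 4 → ℂ) : ℂ :=
  ∏ p : Equiv.Perm (Fin 4) × (Fin 4 → ℤˣ), eval (sact p.1 p.2 x) F

lemma card384 : Fintype.card (Equiv.Perm (Fin 4) × (Fin 4 → ℤˣ)) = 384 := by
  simp [Fintype.card_perm, Nat.factorial]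

lemma NF_smul {F : MvPolynomial (Fin 4) ℂ} {d : ℕ} (hF : F.IsHomogeneous d) (c : ℂ)
    (x : Fin 4 → ℂ) : NF F (c • x) = c ^ (384 * d) * NF F x := by
  simp only [NF, sact_smul, homog_smul hF, Finset.prod_mul_distrib, Finset.prod_const,
    Finset.card_univ, card384]
  rw [← pow_mul, mul_comm d]

lemma NF_deg_bound {F : MvPolynomial (Fin 4) ℂ} {d : ℕ} (hF : F.IsHomogeneous d) :
    ∃ C : ℝ, 0 ≤ C ∧ ∀ x, ‖NF F x‖ ≤ C * ‖x‖ ^ (384 * d) := by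
  have hc : Continuous fun x : Fin 4 → ℂ => NF F x := by
    unfold NF
    refine continuous_finsetProd _ fun p _ => ?_
    refine (MvPolynomial.continuous_eval F).comp ?_
    unfold sact
    fun_prop
  obtain ⟨C, hC⟩ := (isCompact_closedBall (0 : Fin 4 → ℂ) 1).exists_bound_of_continuousOn
      hc.continuousOn
  have hC0 : 0 ≤ C := (norm_nonneg _).trans (hC 0 (by simp))
  refine ⟨C, hC0, fun x => ?_⟩
  by_cases hx : x = 0
  · subst hx
    rcases Nat.eq_zero_or_pos d with h | h
    · subst h
      simpa using hC 0 (by simp)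
    · have := NF_smul hF 0 (0 : Fin 4 → ℂ)
      rw [zero_smul, zero_pow (by positivity), zero_mul] at this
      rw [this]; simp; positivity
  · have hn : 0 < ‖x‖ := norm_pos_iff.mpr hx
    have h1 : x = ((‖x‖ : ℝ) : ℂ) • ((((‖x‖ : ℝ) : ℂ)⁻¹) • x) := by
      rw [smul_smul, mul_inv_cancel₀ (by exact_mod_cast hn.ne'), one_smul]
    have h2 : ‖((((‖x‖ : ℝ) : ℂ)⁻¹) • x)‖ ≤ 1 := by
      rw [norm_smul, norm_inv, Complex.norm_real, norm_norm, inv_mul_cancel₀ hn.ne']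
    calc ‖NF F x‖ = ‖x‖ ^ (384 * d) * ‖NF F ((((‖x‖ : ℝ) : ℂ)⁻¹) • x)‖ := by
          conv_lhs => rw [h1]
          rw [NF_smul hF, norm_mul, norm_pow, Complex.norm_real, norm_norm]
      _ ≤ ‖x‖ ^ (384 * d) * C := by
          refine mul_le_mul_of_nonneg_left (hC _ (by simpa using h2)) (by positivity)
      _ = _ := mul_comm _ _

lemma good_bound {F : MvPolynomial (Fin 4) ℂ} {d m : ℕ} (hF : F.IsHomogeneous d)
    (hv : ∀ v ∈ F4Config, vanishesToOrder F v m) (R : ℝ) :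
    ∃ C : ℝ, 0 ≤ C ∧ ∀ u h : Fin 4 → ℂ, GoodVec u → ‖h‖ ≤ R → ‖eval (u + h) F‖ ≤ C * ‖h‖ ^ m := by
  choose C hC0 hC using fun j => vanish_bound R m F (F4Pts j) (hv _ ⟨j, rfl⟩)
  refine ⟨∑ j, C j, Finset.sum_nonneg fun i _ => hC0 i, fun u h hu hh => ?_⟩
  obtain ⟨j, hj⟩ := hu.exists_pt
  have hle : C j ≤ ∑ j, C j := Finset.single_le_sum (fun i _ => hC0 i) (Finset.mem_univ j)
  refine le_trans ?_ (mul_le_mul_of_nonneg_right hle (by positivity))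
  rcases hj with hj | hj
  · rw [hj]; exact hC j h hh
  · have h1 : u + h = (-1 : ℂ) • (F4Pts j + -h) := by rw [hj]; simp
    rw [h1, homog_smul hF, norm_mul, norm_pow, norm_neg, norm_one, one_pow, one_mul]
    simpa using hC j (-h) (by simpa using hh)

lemma NF_good_bound {F : MvPolynomial (Fin 4) ℂ} {d m : ℕ} (hF : F.IsHomogeneous d)
    (hv : ∀ v ∈ F4Config, vanishesToOrder F v m) (c0 R : ℝ) (hc0 : 0 < c0) (hR : 0 ≤ R) :
    ∃ C : ℝ, 0 ≤ C ∧ ∀ (c : ℂ) (u h : Fin 4 → ℂ), GoodVec u → c0 ≤ ‖c‖ → ‖c‖ ≤ R → ‖h‖ ≤ R →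
      ‖NF F (c • u + h)‖ ≤ C * ‖h‖ ^ (384 * m) := by
  obtain ⟨C, hC0, hC⟩ := good_bound hF hv (R / c0)
  refine ⟨R ^ (384 * d) * (C ^ 384 * (c0⁻¹) ^ (384 * m)), by positivity, fun c u h hu h1 h2 h3 => ?_⟩
  have hcp : 0 < ‖c‖ := hc0.trans_le h1
  have hcne : c ≠ 0 := norm_pos_iff.mp hcp
  have e : c • u + h = c • (u + c⁻¹ • h) := by
    rw [smul_add, smul_smul, mul_inv_cancel₀ hcne, one_smul]
  have hle : ‖c⁻¹ • h‖ ≤ c0⁻¹ * ‖h‖ := by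
    rw [norm_smul, norm_inv]
    gcongr
  have hR' : ‖c⁻¹ • h‖ ≤ R / c0 := by
    refine hle.trans ?_
    rw [div_eq_inv_mul]; gcongr
  have hb : ‖NF F (u + c⁻¹ • h)‖ ≤ C ^ 384 * (c0⁻¹ * ‖h‖) ^ (384 * m) := by
    unfold NF
    rw [norm_prod]
    calc ∏ p : Equiv.Perm (Fin 4) × (Fin 4 → ℤˣ), ‖eval (sact p.1 p.2 (u + c⁻¹ • h)) F‖
        ≤ ∏ p : Equiv.Perm (Fin 4) × (Fin 4 → ℤˣ), (C * (c0⁻¹ * ‖h‖) ^ m) := by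
          refine Finset.prod_le_prod (fun _ _ => norm_nonneg _) fun p _ => ?_
          rw [sact_add]
          refine (hC _ _ (hu.sact _ _) ((sact_norm _ _ _).trans hR')).trans ?_
          gcongr
          exact (sact_norm _ _ _).trans hle
      _ = _ := by
          rw [Finset.prod_const, Finset.card_univ, card384, mul_pow, ← pow_mul, mul_comm m]
  rw [e, NF_smul hF, norm_mul, norm_pow]
  calc ‖c‖ ^ (384 * d) * ‖NF F (u + c⁻¹ • h)‖
      ≤ R ^ (384 * d) * (C ^ 384 * (c0⁻¹ * ‖h‖) ^ (384 * m)) := by gcongr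
    _ = _ := by rw [mul_pow]; ring


/-- the substitution `X_i ↦ ε_i X_i` -/
noncomputable def signSub (ε : Fin 4 → ℤˣ) :
    MvPolynomial (Fin 4) ℂ →ₐ[ℂ] MvPolynomial (Fin 4) ℂ :=
  aeval fun i => C ((ε i : ℤ) : ℂ) * X i

lemma signSub_comp (ε δ : Fin 4 → ℤˣ) (F : MvPolynomial (Fin 4) ℂ) :
    signSub δ (signSub ε F) = signSub (δ * ε) F := by
  have : (signSub δ).comp (signSub ε) = signSub (δ * ε) := by
    ext1 i
    simp only [AlgHom.comp_apply, signSub, aeval_X, map_mul, algHom_C, algebraMap_eq, Pi.mul_apply,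
      Units.val_mul, Int.cast_mul]
    ring
  exact DFunLike.congr_fun this F

lemma signSub_coeff (ε : Fin 4 → ℤˣ) (F : MvPolynomial (Fin 4) ℂ) (s : Fin 4 →₀ ℕ) :
    coeff s (signSub ε F) = (∏ i, ((ε i : ℤ) : ℂ) ^ s i) * coeff s F := by
  induction F using MvPolynomial.induction_on' with
  | monomial t a =>
    have : signSub ε (monomial t a) = monomial t ((∏ i, ((ε i : ℤ) : ℂ) ^ t i) * a) := by
      rw [signSub, aeval_monomial, Finsupp.prod_fintype _ _ (by simp)]
      simp only [mul_pow, Finset.prod_mul_distrib, algebraMap_eq]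
      rw [monomial_eq (s := t), Finsupp.prod_fintype _ _ (by simp)]
      simp only [map_mul, map_prod, map_pow]
      ring
    rw [this, coeff_monomial, coeff_monomial]
    split_ifs with h
    · rw [h]
    · simp
  | add p q hp hq => rw [map_add, coeff_add, coeff_add, hp, hq]; ring

lemma exists_expand (R : MvPolynomial (Fin 4) ℂ) (hR : ∀ ε, signSub ε R = R) :
    ∃ R' : MvPolynomial (Fin 4) ℂ, R = expand 2 R' := by
  have hev : ∀ s ∈ R.support, ∀ i, Even (s i) := by
    intro s hs i
    by_contra hodd
    rw [Nat.not_even_iff_odd] at hodd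
    have h := signSub_coeff (Function.update 1 i (-1)) R s
    rw [hR] at h
    have h2 : (∏ j, (((Function.update (1 : Fin 4 → ℤˣ) i (-1) j : ℤˣ) : ℤ) : ℂ) ^ s j) = -1 := by
      rw [Finset.prod_eq_single i]
      · simp [hodd.neg_one_pow]
      · intro j _ hj; simp [Function.update_of_ne hj]
      · simp
    rw [h2] at h
    have h3 : coeff s R = 0 := by linear_combination h / 2
    exact (mem_support_iff.mp hs) h3
  refine ⟨∑ s ∈ R.support, monomial (s.mapRange (· / 2) (by simp)) (coeff s R), ?_⟩
  rw [map_sum]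
  conv_lhs => rw [R.as_sum]
  refine Finset.sum_congr rfl fun s hs => ?_
  rw [expand_monomial]
  have h2 : 2 • s.mapRange (· / 2) (by simp) = s := by
    ext i
    obtain ⟨r, hr⟩ := hev s hs i
    rw [Finsupp.smul_apply, Finsupp.mapRange_apply, smul_eq_mul, hr]
    omega
  rw [h2]

lemma exists_sym (F : MvPolynomial (Fin 4) ℂ) : ∃ G : MvPolynomial (Fin 4) ℂ,
    ∀ x : Fin 4 → ℂ, NF F x =
      eval (fun i : Fin 4 => eval (fun j => x j ^ 2) (esymm (Fin 4) ℂ (i + 1))) G := by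
  obtain ⟨R', hR'⟩ := exists_expand (∏ ε, signSub ε F) (by
    intro δ
    rw [map_prod]
    simp only [signSub_comp]
    exact Fintype.prod_equiv (Equiv.mulLeft δ) _ _ fun ε => rfl)
  have hsym : (∏ σ : Equiv.Perm (Fin 4), rename σ R').IsSymmetric := by
    intro τ
    rw [map_prod]
    simp only [rename_rename]
    exact Fintype.prod_equiv (Equiv.mulLeft τ) _ _ fun σ => rfl
  obtain ⟨G, hG⟩ := esymmAlgHom_fin_surjective (R := ℂ) (n := 4) (m := 4) le_rfl
    ⟨_, (mem_symmetricSubalgebra _).mpr hsym⟩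
  refine ⟨G, fun x => ?_⟩
  have hG' := congrArg Subtype.val hG
  rw [esymmAlgHom_apply] at hG'
  have h1 : eval (fun j => x j ^ 2) (∏ σ : Equiv.Perm (Fin 4), rename σ R')
      = eval (fun i : Fin 4 => eval (fun j => x j ^ 2) (esymm (Fin 4) ℂ (i + 1))) G := by
    have hG2 : ∏ σ : Equiv.Perm (Fin 4), rename σ R'
        = aeval (fun i : Fin 4 => esymm (Fin 4) ℂ (i + 1)) G := hG'.symm
    rw [hG2, aeval_def, eval₂_eq, map_sum, eval_eq]
    refine Finset.sum_congr rfl fun s _ => ?_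
    simp [map_prod]
  rw [← h1, map_prod, NF, Fintype.prod_prod_type]
  refine Finset.prod_congr rfl fun σ _ => ?_
  have h2 : eval (x ∘ σ) (∏ ε, signSub ε F) = eval (x ∘ σ) (expand 2 R') := by rw [hR']
  rw [eval_rename]
  have h3 : eval ((fun j => x j ^ 2) ∘ σ) R' = eval (x ∘ σ) (expand 2 R') := by
    rw [eval_expand]; rfl
  rw [h3, ← h2, map_prod]
  refine Finset.prod_congr rfl fun ε _ => ?_
  rw [signSub, aeval_def, eval₂_eq, map_sum, eval_eq]
  refine Finset.sum_congr rfl fun s _ => ?_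
  simp [map_prod, sact]

lemma esymm4 (X : Fin 4 → ℂ) (i : Fin 4) : eval X (esymm (Fin 4) ℂ (i + 1)) =
    ![X 0 + X 1 + X 2 + X 3,
      X 0 * X 1 + X 0 * X 2 + X 0 * X 3 + X 1 * X 2 + X 1 * X 3 + X 2 * X 3,
      X 0 * X 1 * X 2 + X 0 * X 1 * X 3 + X 0 * X 2 * X 3 + X 1 * X 2 * X 3,
      X 0 * X 1 * X 2 * X 3] i := by
  have p1 : Finset.powersetCard 1 (Finset.univ : Finset (Fin 4)) = {{0}, {1}, {2}, {3}} := by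
    decide
  have p2 : Finset.powersetCard 2 (Finset.univ : Finset (Fin 4))
    = {{0, 1}, {0, 2}, {0, 3}, {1, 2}, {1, 3}, {2, 3}} := by decide
  have p3 : Finset.powersetCard 3 (Finset.univ : Finset (Fin 4))
    = {{0, 1, 2}, {0, 1, 3}, {0, 2, 3}, {1, 2, 3}} := by decide
  have p4 : Finset.powersetCard 4 (Finset.univ : Finset (Fin 4)) = {{0, 1, 2, 3}} := by decide
  rw [esymm, map_sum]
  simp only [map_prod, eval_X]
  fin_cases i
  · simp only [Fin.mk_zero, zero_add, p1]
    repeat rw [Finset.sum_insert (by decide)]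
    simp [Finset.sum_singleton]; ring
  · simp only [show ((⟨1, by norm_num⟩ : Fin 4) : ℕ) + 1 = 2 from rfl, p2]
    repeat rw [Finset.sum_insert (by decide)]
    simp [Finset.prod_insert]; ring
  · simp only [show ((⟨2, by norm_num⟩ : Fin 4) : ℕ) + 1 = 3 from rfl, p3]
    repeat rw [Finset.sum_insert (by decide)]
    simp [Finset.prod_insert]; ring
  · simp only [show ((⟨3, by norm_num⟩ : Fin 4) : ℕ) + 1 = 4 from rfl, p4]
    simp [Finset.prod_insert]; ring

/-- `(e1, e2, e3, e4)` are the elementary symmetric functions of the squares of `x` -/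
def IsES (x : Fin 4 → ℂ) (e1 e2 e3 e4 : ℂ) : Prop :=
  x 0 ^ 2 + x 1 ^ 2 + x 2 ^ 2 + x 3 ^ 2 = e1 ∧
  x 0 ^ 2 * x 1 ^ 2 + x 0 ^ 2 * x 2 ^ 2 + x 0 ^ 2 * x 3 ^ 2 + x 1 ^ 2 * x 2 ^ 2
    + x 1 ^ 2 * x 3 ^ 2 + x 2 ^ 2 * x 3 ^ 2 = e2 ∧
  x 0 ^ 2 * x 1 ^ 2 * x 2 ^ 2 + x 0 ^ 2 * x 1 ^ 2 * x 3 ^ 2 + x 0 ^ 2 * x 2 ^ 2 * x 3 ^ 2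
    + x 1 ^ 2 * x 2 ^ 2 * x 3 ^ 2 = e3 ∧
  x 0 ^ 2 * x 1 ^ 2 * x 2 ^ 2 * x 3 ^ 2 = e4

lemma exists_sym' (F : MvPolynomial (Fin 4) ℂ) : ∃ G : MvPolynomial (Fin 4) ℂ,
    ∀ x e1 e2 e3 e4, IsES x e1 e2 e3 e4 → NF F x = eval ![e1, e2, e3, e4] G := by
  obtain ⟨G, hG⟩ := exists_sym F
  refine ⟨G, fun x e1 e2 e3 e4 ⟨h1, h2, h3, h4⟩ => ?_⟩
  rw [hG]
  congr 2
  funext i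
  rw [esymm4, h1, h2, h3, h4]

lemma sym_zero {F G : MvPolynomial (Fin 4) ℂ}
    (hG : ∀ x e1 e2 e3 e4, IsES x e1 e2 e3 e4 → NF F x = eval ![e1, e2, e3, e4] G)
    (h0 : G = 0) : F = 0 := by
  have hN : ∀ x, NF F x = 0 := by
    intro x
    rw [hG x _ _ _ _ ⟨rfl, rfl, rfl, rfl⟩, h0, map_zero]
  have hP : ∏ p : Equiv.Perm (Fin 4) × (Fin 4 → ℤˣ), rename p.1 (signSub p.2 F) = 0 := by
    refine MvPolynomial.funext fun x => ?_
    rw [map_prod, map_zero, ← hN x, NF]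
    refine Finset.prod_congr rfl fun p _ => ?_
    rw [eval_rename]
    rw [signSub, aeval_def, eval₂_eq, map_sum, eval_eq]
    refine Finset.sum_congr rfl fun s _ => ?_
    simp [map_prod, sact]
  obtain ⟨p, _, hp⟩ := Finset.prod_eq_zero_iff.mp hP
  have h1 : signSub p.2 F = 0 := rename_injective _ p.1.injective (by rw [hp, map_zero])
  have h2 : signSub p.2 (signSub p.2 F) = F := by
    rw [signSub_comp]
    have : p.2 * p.2 = 1 := by funext i; simp
    rw [this, signSub]
    simp
  rw [← h2, h1, map_zero]


lemma root_bound {r K t : ℝ} (hK : 1 ≤ K) (ht : 0 ≤ t)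
    (h : r ^ 4 ≤ K * t * r ^ 3 + K * t ^ 2 * r ^ 2 + K * t ^ 3 * r + K * t ^ 4) :
    r ≤ 4 * K * t := by
  by_contra hc
  push Not at hc
  set a := K * t with ha
  have ha0 : 0 ≤ a := by positivity
  have hr : 0 < r := by nlinarith
  have hta : t ≤ a := by nlinarith
  have hra : a < r / 4 := by nlinarith
  have h1 : a * r ^ 3 ≤ r / 4 * r ^ 3 := by gcongr
  have h2 : K * t ^ 2 * r ^ 2 ≤ r / 4 * (r / 4) * r ^ 2 := by
    have : K * t ^ 2 = a * t := by rw [ha]; ring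
    rw [this]; gcongr; linarith
  have h3 : K * t ^ 3 * r ≤ r / 4 * (r / 4) * (r / 4) * r := by
    have : K * t ^ 3 = a * t * t := by rw [ha]; ring
    rw [this]; gcongr <;> linarith
  have h4 : K * t ^ 4 ≤ r / 4 * (r / 4) * (r / 4) * (r / 4) := by
    have : K * t ^ 4 = a * t * t * t := by rw [ha]; ring
    rw [this]; gcongr <;> linarith
  have hr4 : 0 < r ^ 4 := by positivity
  nlinarith

lemma quartic_bound {z a b c d : ℂ} {K t : ℝ} (hK : 1 ≤ K) (ht : 0 ≤ t)
    (h : z ^ 4 + a * z ^ 3 + b * z ^ 2 + c * z + d = 0)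
    (ha : ‖a‖ ≤ K * t) (hb : ‖b‖ ≤ K * t ^ 2) (hc : ‖c‖ ≤ K * t ^ 3) (hd : ‖d‖ ≤ K * t ^ 4) :
    ‖z‖ ≤ 4 * K * t := by
  refine root_bound hK ht ?_
  have h1 : z ^ 4 = -(a * z ^ 3 + b * z ^ 2 + c * z + d) := by linear_combination h
  have h2 : ‖z‖ ^ 4 ≤ ‖a‖ * ‖z‖ ^ 3 + ‖b‖ * ‖z‖ ^ 2 + ‖c‖ * ‖z‖ + ‖d‖ := by
    rw [← norm_pow, h1, norm_neg]
    calc _ ≤ ‖a * z ^ 3‖ + ‖b * z ^ 2‖ + ‖c * z‖ + ‖d‖ := norm_add₄_le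
      _ = _ := by simp
  refine h2.trans ?_
  gcongr

lemma exists_max_root (p : Polynomial ℂ) (hp : 0 < p.degree) :
    ∃ z, p.IsRoot z ∧ ∀ w, p.IsRoot w → ‖w‖ ≤ ‖z‖ := by
  have h0 : p ≠ 0 := by rintro rfl; simp at hp
  obtain ⟨z, hz⟩ := IsAlgClosed.exists_root p hp.ne'
  obtain ⟨y, hy, hmax⟩ := p.roots.toFinset.exists_max_image (fun w => ‖w‖)
    ⟨z, by simp [h0]; exact hz⟩
  refine ⟨y, by simpa [h0] using hy, fun w hw => hmax w (by simp [h0]; exact hw)⟩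

lemma exists_max_quartic (a b c d : ℂ) :
    ∃ z, z ^ 4 + a * z ^ 3 + b * z ^ 2 + c * z + d = 0 ∧
      ∀ w, w ^ 4 + a * w ^ 3 + b * w ^ 2 + c * w + d = 0 → ‖w‖ ≤ ‖z‖ := by
  have h := exists_max_root (Polynomial.X ^ 4 + Polynomial.C a * Polynomial.X ^ 3
    + Polynomial.C b * Polynomial.X ^ 2 + Polynomial.C c * Polynomial.X + Polynomial.C d) (by
      have : (Polynomial.X ^ 4 + Polynomial.C a * Polynomial.X ^ 3
        + Polynomial.C b * Polynomial.X ^ 2 + Polynomial.C c * Polynomial.X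
        + Polynomial.C d).degree = 4 := by compute_degree!
      rw [this]; norm_num)
  simpa [Polynomial.IsRoot] using h

lemma exists_max_cubic (b c d : ℂ) :
    ∃ z, z ^ 3 + b * z ^ 2 + c * z + d = 0 ∧
      ∀ w, w ^ 3 + b * w ^ 2 + c * w + d = 0 → ‖w‖ ≤ ‖z‖ := by
  have h := exists_max_root (Polynomial.X ^ 3
    + Polynomial.C b * Polynomial.X ^ 2 + Polynomial.C c * Polynomial.X + Polynomial.C d) (by
      have : (Polynomial.X ^ 3
        + Polynomial.C b * Polynomial.X ^ 2 + Polynomial.C c * Polynomial.X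
        + Polynomial.C d).degree = 3 := by compute_degree!
      rw [this]; norm_num)
  simpa [Polynomial.IsRoot] using h

lemma exists_max_quadratic (c d : ℂ) :
    ∃ z, z ^ 2 + c * z + d = 0 ∧
      ∀ w, w ^ 2 + c * w + d = 0 → ‖w‖ ≤ ‖z‖ := by
  have h := exists_max_root (Polynomial.X ^ 2 + Polynomial.C c * Polynomial.X + Polynomial.C d) (by
      have : (Polynomial.X ^ 2 + Polynomial.C c * Polynomial.X
        + Polynomial.C d).degree = 2 := by compute_degree!
      rw [this]; norm_num)
  simpa [Polynomial.IsRoot] using h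

lemma exists_ES (e1 e2 e3 e4 : ℂ) : ∃ x : Fin 4 → ℂ, IsES x e1 e2 e3 e4 ∧
    (‖x 1‖ ≤ ‖x 0‖ ∧ ‖x 2‖ ≤ ‖x 1‖ ∧ ‖x 3‖ ≤ ‖x 1‖) := by
  obtain ⟨a, ha, hma⟩ := exists_max_quartic (-e1) e2 (-e3) e4
  obtain ⟨b, hb, hmb⟩ := exists_max_cubic (-(e1 - a)) (e2 - a * (e1 - a))
    (-(e3 - a * (e2 - a * (e1 - a))))
  obtain ⟨c, hc, hmc⟩ := exists_max_quadratic (-(e1 - a - b)) (e2 - a * (e1 - a) - b * (e1 - a - b))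
  set d := e1 - a - b - c with hd
  have hd2 : d ^ 2 + (-(e1 - a - b)) * d + (e2 - a * (e1 - a) - b * (e1 - a - b)) = 0 := by
    rw [hd]; linear_combination hc
  have hba : ‖b‖ ≤ ‖a‖ := by
    apply hma
    linear_combination (b - a) * hb + ha
  have hq : ∀ y, y ^ 2 + (-(e1 - a - b)) * y + (e2 - a * (e1 - a) - b * (e1 - a - b)) = 0 →
      ‖y‖ ≤ ‖b‖ := by
    intro y hy
    apply hmb
    linear_combination (y - b) * hy + hb
  have hcb := hq c hc
  have hdb := hq d hd2
  have sq : ∀ z : ℂ, ∃ y : ℂ, y ^ 2 = z := fun z =>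
    IsAlgClosed.exists_pow_nat_eq z (by norm_num)
  obtain ⟨x0, h0⟩ := sq a
  obtain ⟨x1, h1⟩ := sq b
  obtain ⟨x2, h2⟩ := sq c
  obtain ⟨x3, h3⟩ := sq d
  have mono : ∀ x y : ℂ, ‖x ^ 2‖ ≤ ‖y ^ 2‖ → ‖x‖ ≤ ‖y‖ := by
    intro x y h
    rw [norm_pow, norm_pow] at h
    exact le_of_sq_le_sq h (norm_nonneg _)
  refine ⟨![x0, x1, x2, x3], ⟨?_, ?_, ?_, ?_⟩, ?_, ?_, ?_⟩
  · simp [h0, h1, h2, h3, hd]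
  · simp [h0, h1, h2, h3]; rw [hd]; linear_combination -hc
  · simp [h0, h1, h2, h3]; rw [hd]; linear_combination hb - (a + b) * hc
  · simp [h0, h1, h2, h3]; rw [hd]; linear_combination -ha + a * hb - a * b * hc
  · exact mono _ _ (by simpa [h0, h1] using hba)
  · exact mono _ _ (by simpa [h2, h1] using hcb)
  · exact mono _ _ (by simpa [h3, h1] using hdb)

lemma IsES.root {x : Fin 4 → ℂ} {e1 e2 e3 e4 : ℂ} (h : IsES x e1 e2 e3 e4) (i : Fin 4) :
    (x i ^ 2) ^ 4 + (-e1) * (x i ^ 2) ^ 3 + e2 * (x i ^ 2) ^ 2 + (-e3) * (x i ^ 2) + e4 = 0 := by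
  obtain ⟨rfl, rfl, rfl, rfl⟩ := h
  fin_cases i <;> simp <;> ring

lemma IsES.bound {x : Fin 4 → ℂ} {e1 e2 e3 e4 : ℂ} (h : IsES x e1 e2 e3 e4) {K t : ℝ}
    (hK : 1 ≤ K) (ht : 0 ≤ t) (h1 : ‖e1‖ ≤ K * t) (h2 : ‖e2‖ ≤ K * t ^ 2)
    (h3 : ‖e3‖ ≤ K * t ^ 3) (h4 : ‖e4‖ ≤ K * t ^ 4) (i : Fin 4) : ‖x i‖ ^ 2 ≤ 4 * K * t := by
  rw [← norm_pow]
  exact quartic_bound hK ht (h.root i) (by simpa using h1) h2 (by simpa using h3) h4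

lemma IsES.shift {x : Fin 4 → ℂ} {e1 e2 e3 e4 : ℂ} (h : IsES x e1 e2 e3 e4) (i : Fin 4) :
    (x i ^ 2 - e1 / 4) ^ 4 + 0 * (x i ^ 2 - e1 / 4) ^ 3
      + (e2 - 3 * e1 ^ 2 / 8) * (x i ^ 2 - e1 / 4) ^ 2
      + (-e3 + e1 * e2 / 2 - e1 ^ 3 / 8) * (x i ^ 2 - e1 / 4)
      + (e4 - e1 * e3 / 4 + e1 ^ 2 * e2 / 16 - 3 * e1 ^ 4 / 256) = 0 := by
  linear_combination h.root i

lemma norm_sq_le_of {x : Fin 4 → ℂ} {B : ℝ} (hB : 0 ≤ B) (h : ∀ i, ‖x i‖ ^ 2 ≤ B) :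
    ‖x‖ ^ 2 ≤ B := by
  have : ‖x‖ ≤ Real.sqrt B :=
    (pi_norm_le_iff_of_nonneg (Real.sqrt_nonneg _)).mpr fun i => Real.le_sqrt_of_sq_le (h i)
  calc ‖x‖ ^ 2 ≤ Real.sqrt B ^ 2 := by gcongr
    _ = B := Real.sq_sqrt hB


lemma G_inf {F G : MvPolynomial (Fin 4) ℂ} {d : ℕ} (hF : F.IsHomogeneous d)
    (hG : ∀ x e1 e2 e3 e4, IsES x e1 e2 e3 e4 → NF F x = eval ![e1, e2, e3, e4] G)
    (K : ℝ) (hK : 1 ≤ K) :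
    ∃ C : ℝ, 0 ≤ C ∧ ∀ (e1 e2 e3 e4 : ℂ) (t : ℝ), 0 ≤ t → ‖e1‖ ≤ K * t → ‖e2‖ ≤ K * t ^ 2 →
      ‖e3‖ ≤ K * t ^ 3 → ‖e4‖ ≤ K * t ^ 4 → ‖eval ![e1, e2, e3, e4] G‖ ≤ C * t ^ (192 * d) := by
  obtain ⟨C, hC0, hC⟩ := NF_deg_bound hF
  refine ⟨C * (4 * K) ^ (192 * d), by positivity, fun e1 e2 e3 e4 t ht h1 h2 h3 h4 => ?_⟩
  obtain ⟨x, hx, -⟩ := exists_ES e1 e2 e3 e4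
  rw [← hG x _ _ _ _ hx]
  have hb := norm_sq_le_of (by positivity) (hx.bound hK ht h1 h2 h3 h4)
  calc ‖NF F x‖ ≤ C * ‖x‖ ^ (384 * d) := hC x
    _ = C * (‖x‖ ^ 2) ^ (192 * d) := by rw [← pow_mul]; ring_nf
    _ ≤ C * (4 * K * t) ^ (192 * d) := by gcongr
    _ = _ := by rw [mul_pow]; ring

lemma IsES.bound' {x : Fin 4 → ℂ} {e1 e2 e3 e4 : ℂ} (h : IsES x e1 e2 e3 e4) {K : ℝ}
    (hK : 1 ≤ K) (h1 : ‖e1‖ ≤ K) (h2 : ‖e2‖ ≤ K)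
    (h3 : ‖e3‖ ≤ K) (h4 : ‖e4‖ ≤ K) (i : Fin 4) : ‖x i‖ ^ 2 ≤ 4 * K := by
  simpa using h.bound hK zero_le_one (by simpa using h1) (by simpa using h2) (by simpa using h3)
    (by simpa using h4) i

lemma good1 : GoodVec ![1, 0, 0, 0] := by
  refine ⟨![1, 0, 0, 0], fun i => by fin_cases i <;> simp, Or.inl (by decide)⟩

lemma good2 (s : ℂ) (hs : s = 1 ∨ s = -1) : GoodVec ![1, s, 0, 0] := by
  rcases hs with rfl | rfl
  · exact ⟨![1, 1, 0, 0], fun i => by fin_cases i <;> simp, Or.inr (Or.inl (by decide))⟩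
  · exact ⟨![1, -1, 0, 0], fun i => by fin_cases i <;> simp, Or.inr (Or.inl (by decide))⟩

lemma good4 (u : Fin 4 → ℂ) (hu : ∀ i, u i = 1 ∨ u i = -1) : GoodVec u := by
  have : ∀ i, ∃ s : SignType, u i = ((s : ℤ) : ℂ) ∧ s ≠ 0 := by
    intro i
    rcases hu i with h | h
    · exact ⟨1, by simp [h], by decide⟩
    · exact ⟨-1, by simp [h], by decide⟩
  choose s hs hs0 using this
  refine ⟨s, hs, Or.inr (Or.inr ?_)⟩
  rw [Finset.filter_true_of_mem fun i _ => hs0 i]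
  simp

lemma sign_choice (x c : ℂ) : ∃ s : ℂ, (s = 1 ∨ s = -1) ∧ ‖c‖ * ‖x - s * c‖ ≤ ‖x ^ 2 - c ^ 2‖ := by
  have h1 : x ^ 2 - c ^ 2 = (x - c) * (x + c) := by ring
  have h2 : 2 * ‖c‖ ≤ ‖x - c‖ + ‖x + c‖ := by
    calc 2 * ‖c‖ = ‖(x + c) - (x - c)‖ := by
          rw [show (x + c) - (x - c) = 2 * c by ring]; simp
      _ ≤ ‖x + c‖ + ‖x - c‖ := norm_sub_le _ _
      _ = _ := add_comm _ _
  rw [h1, norm_mul]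
  by_cases h : ‖x - c‖ ≤ ‖x + c‖
  · refine ⟨1, Or.inl rfl, ?_⟩
    rw [one_mul, mul_comm]
    gcongr; linarith
  · refine ⟨-1, Or.inr rfl, ?_⟩
    rw [show x - -1 * c = x + c by ring]
    gcongr; linarith

lemma norm_le_one_add_sq (x : ℝ) : x ≤ 1 + x ^ 2 := by nlinarith [sq_nonneg (x - 1)]

lemma G_T2 {F G : MvPolynomial (Fin 4) ℂ} {d m : ℕ} (hF : F.IsHomogeneous d)
    (hv : ∀ v ∈ F4Config, vanishesToOrder F v m)
    (hG : ∀ x e1 e2 e3 e4, IsES x e1 e2 e3 e4 → NF F x = eval ![e1, e2, e3, e4] G)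
    (κ K : ℝ) (hκ : 0 < κ) (hK : 1 ≤ K) :
    ∃ C : ℝ, 0 ≤ C ∧ ∀ (e1 e2 e3 e4 : ℂ) (t : ℝ), 0 ≤ t → t ≤ 1 → κ ≤ ‖e1‖ → ‖e1‖ ≤ K →
      ‖e2 - 3 * e1 ^ 2 / 8‖ ≤ K * t ^ 2 →
      ‖-e3 + e1 * e2 / 2 - e1 ^ 3 / 8‖ ≤ K * t ^ 3 →
      ‖e4 - e1 * e3 / 4 + e1 ^ 2 * e2 / 16 - 3 * e1 ^ 4 / 256‖ ≤ K * t ^ 4 →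
      ‖eval ![e1, e2, e3, e4] G‖ ≤ C * t ^ (384 * m) := by
  set c0 : ℝ := Real.sqrt (κ / 4) with hc0
  have hc0p : 0 < c0 := Real.sqrt_pos.mpr (by positivity)
  set L : ℝ := 4 * K / c0 with hL
  have hLp : 0 < L := by positivity
  obtain ⟨C, hC0, hC⟩ := NF_good_bound hF hv c0 (L + 1 + K) hc0p (by positivity)
  refine ⟨C * L ^ (384 * m), by positivity, fun e1 e2 e3 e4 t ht ht1 hl hu h2 h3 h4 => ?_⟩
  obtain ⟨x, hx, -⟩ := exists_ES e1 e2 e3 e4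
  rw [← hG x _ _ _ _ hx]
  obtain ⟨c, hc⟩ := IsAlgClosed.exists_pow_nat_eq (e1 / 4) (n := 2) (by norm_num)
  have hcn : ‖c‖ ^ 2 = ‖e1‖ / 4 := by
    rw [← norm_pow, hc]; simp
  have hc1 : c0 ≤ ‖c‖ := Real.sqrt_le_iff.mpr ⟨norm_nonneg _, by rw [hcn]; linarith⟩
  have hc2 : ‖c‖ ≤ 1 + K := by
    have := norm_le_one_add_sq ‖c‖
    rw [hcn] at this; linarith
  choose s hs hs2 using fun i => sign_choice (x i) c
  have hz : ∀ i, ‖x i ^ 2 - c ^ 2‖ ≤ 4 * K * t := by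
    intro i
    rw [hc]
    exact quartic_bound hK ht (hx.shift i) (by simp; positivity) h2 h3 h4
  have hh : ∀ i, ‖x i - s i * c‖ ≤ L * t := by
    intro i
    have h5 : c0 * ‖x i - s i * c‖ ≤ 4 * K * t :=
      (mul_le_mul_of_nonneg_right hc1 (norm_nonneg _)).trans ((hs2 i).trans (hz i))
    rw [hL, div_mul_eq_mul_div, le_div_iff₀ hc0p]
    linarith
  have hn : ‖(fun i => x i - s i * c)‖ ≤ L * t :=
    (pi_norm_le_iff_of_nonneg (by positivity)).mpr hh
  have e : x = c • s + fun i => x i - s i * c := by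
    funext i; simp; ring
  have hb := hC c s _ (good4 s hs) hc1 (by linarith) (hn.trans (by nlinarith))
  rw [← e] at hb
  calc ‖NF F x‖ ≤ _ := hb
    _ ≤ C * (L * t) ^ (384 * m) := by gcongr
    _ = _ := by rw [mul_pow]; ring

lemma pow_sq_bound {a B : ℝ} (h : a ^ 2 ≤ B) (m : ℕ) :
    a ^ (384 * m) ≤ B ^ (192 * m) := by
  calc a ^ (384 * m) = (a ^ 2) ^ (192 * m) := by rw [← pow_mul]; ring_nf
    _ ≤ _ := by gcongr

lemma G_T1 {F G : MvPolynomial (Fin 4) ℂ} {d m : ℕ} (hF : F.IsHomogeneous d)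
    (hv : ∀ v ∈ F4Config, vanishesToOrder F v m)
    (hG : ∀ x e1 e2 e3 e4, IsES x e1 e2 e3 e4 → NF F x = eval ![e1, e2, e3, e4] G)
    (κ K : ℝ) (hκ : 0 < κ) (hK : 1 ≤ K) :
    ∃ C : ℝ, 0 ≤ C ∧ ∀ (e1 e2 e3 e4 : ℂ) (t : ℝ), 0 ≤ t → t ≤ 1 → κ ≤ ‖e1‖ → ‖e1‖ ≤ K →
      ‖e2‖ ≤ K * t → ‖e3‖ ≤ K * t ^ 2 → ‖e4‖ ≤ K * t ^ 3 →
      ‖eval ![e1, e2, e3, e4] G‖ ≤ C * t ^ (192 * m) := by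
  set μ : ℝ := κ / 4 with hμ
  have hμp : 0 < μ := by positivity
  set c0 : ℝ := Real.sqrt μ with hc0
  have hc0p : 0 < c0 := Real.sqrt_pos.mpr (by positivity)
  -- bounds for the elementary symmetric functions of the last three
  set K3 : ℝ := K / μ with hK3
  set K2 : ℝ := (K + K3) / μ with hK2
  set K1 : ℝ := (K + K2) / μ with hK1
  have hK3p : 0 < K3 := by positivity
  have hK2p : 0 < K2 := by positivity
  have hK1p : 0 < K1 := by positivity
  set L : ℝ := 1 + K1 + K2 + K3 with hL
  obtain ⟨C, hC0, hC⟩ := NF_good_bound hF hv c0 (1 + 4 * K + 4 * L) hc0p (by positivity)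
  refine ⟨C * (4 * L) ^ (192 * m), by positivity, fun e1 e2 e3 e4 t ht ht1 hl hu h2 h3 h4 => ?_⟩
  obtain ⟨x, hx, ho1, ho2, ho3⟩ := exists_ES e1 e2 e3 e4
  rw [← hG x _ _ _ _ hx]
  have hR := hx.bound' hK hu (h2.trans (by nlinarith)) (h3.trans (by nlinarith [pow_le_one₀ ht ht1 (n := 2)]))
    (h4.trans (by nlinarith [pow_le_one₀ ht ht1 (n := 3)]))
  obtain ⟨E1, E2, E3, E4⟩ := hx
  have sqm : ∀ {a b : ℂ}, ‖a‖ ≤ ‖b‖ → ‖a ^ 2‖ ≤ ‖b ^ 2‖ := by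
    intro a b h
    rw [norm_pow, norm_pow]; gcongr
  set X0 := x 0 ^ 2 with hX0
  set X1 := x 1 ^ 2 with hX1
  set X2 := x 2 ^ 2 with hX2
  set X3 := x 3 ^ 2 with hX3
  have hX0l : μ ≤ ‖X0‖ := by
    have h5 : ‖e1‖ ≤ ‖X0‖ + ‖X1‖ + ‖X2‖ + ‖X3‖ := by rw [← E1]; exact norm_add₄_le
    have := sqm ho1
    have := sqm ho2
    have := sqm ho3
    simp only [← hX0, ← hX1, ← hX2, ← hX3] at *
    linarith
  have hdiv : ∀ (s y : ℂ) (B : ℝ), X0 * s = y → ‖y‖ ≤ B → ‖s‖ ≤ B / μ := by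
    intro s y B h hB
    rw [le_div_iff₀ hμp]
    calc ‖s‖ * μ ≤ ‖s‖ * ‖X0‖ := by gcongr
      _ = ‖y‖ := by rw [← h, norm_mul, mul_comm]
      _ ≤ B := hB
  have hs3 : ‖X1 * X2 * X3‖ ≤ K3 * t ^ 3 := by
    have := hdiv (X1 * X2 * X3) e4 _ (by rw [← E4]; ring) h4
    rw [hK3, div_mul_eq_mul_div]; exact this
  have t32 : t ^ 3 ≤ t ^ 2 := pow_le_pow_of_le_one ht ht1 (by norm_num)
  have t21 : t ^ 2 ≤ t := by nlinarith
  have hs2 : ‖X1 * X2 + X1 * X3 + X2 * X3‖ ≤ K2 * t ^ 2 := by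
    have := hdiv (X1 * X2 + X1 * X3 + X2 * X3) (e3 - X1 * X2 * X3) ((K + K3) * t ^ 2)
      (by rw [← E3]; ring) ((norm_sub_le _ _).trans (by nlinarith))
    rw [hK2, div_mul_eq_mul_div]; exact this
  have hs1 : ‖X1 + X2 + X3‖ ≤ K1 * t := by
    have := hdiv (X1 + X2 + X3) (e2 - (X1 * X2 + X1 * X3 + X2 * X3)) ((K + K2) * t)
      (by rw [← E2]; ring) ((norm_sub_le _ _).trans (by nlinarith))
    rw [hK1, div_mul_eq_mul_div]; exact this
  have hroot : ∀ z : ℂ, (z - X1) * (z - X2) * (z - X3) = 0 → ‖z‖ ≤ 4 * L * t := by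
    intro z hz
    refine quartic_bound (a := -(X1 + X2 + X3)) (b := X1 * X2 + X1 * X3 + X2 * X3)
      (c := -(X1 * X2 * X3)) (d := 0) (by linarith) ht (by linear_combination z * hz) ?_ ?_ ?_ ?_
    · rw [norm_neg]; exact hs1.trans (by gcongr; linarith)
    · exact hs2.trans (by gcongr; linarith)
    · rw [norm_neg]; exact hs3.trans (by gcongr; linarith)
    · simp; positivity
  have hLt : 0 ≤ 4 * L * t := by positivity
  have hn : ‖(![0, x 1, x 2, x 3] : Fin 4 → ℂ)‖ ^ 2 ≤ 4 * L * t := by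
    refine norm_sq_le_of hLt fun i => ?_
    fin_cases i
    · simpa using hLt
    · have := hroot X1 (by ring)
      rw [hX1, norm_pow] at this; simpa using this
    · have := hroot X2 (by ring)
      rw [hX2, norm_pow] at this; simpa using this
    · have := hroot X3 (by ring)
      rw [hX3, norm_pow] at this; simpa using this
  have e : x = (x 0) • ![1, 0, 0, 0] + ![0, x 1, x 2, x 3] := by
    funext i; fin_cases i <;> simp
  have hc1 : c0 ≤ ‖x 0‖ :=
    Real.sqrt_le_iff.mpr ⟨norm_nonneg _, by rw [hX0, norm_pow] at hX0l; exact hX0l⟩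
  have hc2 := norm_le_one_add_sq ‖x 0‖
  have hc3 := norm_le_one_add_sq ‖(![0, x 1, x 2, x 3] : Fin 4 → ℂ)‖
  have := hR 0
  have hLt1 : 4 * L * t ≤ 4 * L := mul_le_of_le_one_right (by positivity) ht1
  have hb := hC (x 0) _ (![0, x 1, x 2, x 3]) good1 hc1 (by linarith) (by linarith)
  rw [← e] at hb
  calc ‖NF F x‖ ≤ _ := hb
    _ ≤ C * (4 * L * t) ^ (192 * m) := by
        gcongr; exact pow_sq_bound hn m
    _ = _ := by rw [mul_pow]; ring


set_option maxHeartbeats 2000000 in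
lemma G_S {F G : MvPolynomial (Fin 4) ℂ} {d m : ℕ} (hF : F.IsHomogeneous d)
    (hv : ∀ v ∈ F4Config, vanishesToOrder F v m)
    (hG : ∀ x e1 e2 e3 e4, IsES x e1 e2 e3 e4 → NF F x = eval ![e1, e2, e3, e4] G)
    (κ K : ℝ) (hκ : 0 < κ) (hK : 1 ≤ K) :
    ∃ C : ℝ, 0 ≤ C ∧ ∀ (e1 e2 e3 e4 : ℂ) (t : ℝ), 0 ≤ t → t ≤ 1 → ‖e1‖ ≤ K → κ ≤ ‖e2‖ →
      ‖e2‖ ≤ K → ‖e3‖ ≤ K * t → ‖e4‖ ≤ K * t ^ 2 → ‖e1 ^ 2 - 4 * e2‖ ≤ K * t →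
      ‖eval ![e1, e2, e3, e4] G‖ ≤ C * t ^ (192 * m) := by
  set μ : ℝ := κ / (24 * K) with hμ
  have hμp : 0 < μ := by positivity
  set c0 : ℝ := Real.sqrt μ with hc0
  have hc0p : 0 < c0 := Real.sqrt_pos.mpr (by positivity)
  set Kq : ℝ := K / μ ^ 2 with hKq
  set Kp : ℝ := (K + 8 * K * Kq) / μ ^ 2 with hKp
  have hKqp : 0 < Kq := by positivity
  have hKpp : 0 < Kp := by positivity
  set L : ℝ := 1 + Kp + Kq with hL
  set J : ℝ := K + 2 * K * Kp + Kp ^ 2 + 4 * (8 * K * Kp + Kq) with hJ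
  have hJp : 0 < J := by positivity
  set M : ℝ := 4 * L + J / μ with hM
  have hMp : 0 < M := by positivity
  obtain ⟨C, hC0, hC⟩ := NF_good_bound hF hv c0 (1 + 4 * K + M) hc0p (by positivity)
  refine ⟨C * M ^ (192 * m), by positivity, fun e1 e2 e3 e4 t ht ht1 h1 hl h2 h3 h4 hdisc => ?_⟩
  obtain ⟨x, hx, ho1, ho2, ho3⟩ := exists_ES e1 e2 e3 e4
  rw [← hG x _ _ _ _ hx]
  have t21 : t ^ 2 ≤ t := by nlinarith
  have hR := hx.bound' hK h1 h2 (h3.trans (by nlinarith)) (h4.trans (by nlinarith))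
  obtain ⟨E1, E2, E3, E4⟩ := hx
  have sqm : ∀ {a b : ℂ}, ‖a‖ ≤ ‖b‖ → ‖a ^ 2‖ ≤ ‖b ^ 2‖ := by
    intro a b h
    rw [norm_pow, norm_pow]; gcongr
  have ho1' := sqm ho1
  have ho2' := sqm ho2
  have ho3' := sqm ho3
  have hR0 : ‖x 0 ^ 2‖ ≤ 4 * K := by rw [norm_pow]; exact hR 0
  have hR1 : ‖x 1 ^ 2‖ ≤ 4 * K := by rw [norm_pow]; exact hR 1
  set X0 := x 0 ^ 2 with hX0
  set X1 := x 1 ^ 2 with hX1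
  set X2 := x 2 ^ 2 with hX2
  set X3 := x 3 ^ 2 with hX3
  have hX1l : μ ≤ ‖X1‖ := by
    have h5 : ‖e2‖ ≤ ‖X0‖ * ‖X1‖ + ‖X0‖ * ‖X2‖ + ‖X0‖ * ‖X3‖ + ‖X1‖ * ‖X2‖ + ‖X1‖ * ‖X3‖
        + ‖X2‖ * ‖X3‖ := by
      rw [← E2]
      refine (norm_add_le _ _).trans (add_le_add ((norm_add_le _ _).trans (add_le_add
        ((norm_add₄_le).trans ?_) ?_)) ?_) <;> simp
    have a1 : ‖X0‖ * ‖X2‖ ≤ ‖X0‖ * ‖X1‖ := by gcongr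
    have a2 : ‖X0‖ * ‖X3‖ ≤ ‖X0‖ * ‖X1‖ := by gcongr
    have a3 : ‖X1‖ * ‖X2‖ ≤ ‖X0‖ * ‖X1‖ := by gcongr
    have a4 : ‖X1‖ * ‖X3‖ ≤ ‖X0‖ * ‖X1‖ := by gcongr
    have a5 : ‖X2‖ * ‖X3‖ ≤ ‖X0‖ * ‖X1‖ := by gcongr; exact ho2'.trans ho1'
    have a6 : ‖X0‖ * ‖X1‖ ≤ 4 * K * ‖X1‖ := by gcongr
    rw [hμ, div_le_iff₀ (by positivity)]
    nlinarith
  have hX0l : μ ≤ ‖X0‖ := hX1l.trans ho1'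
  have hdiv : ∀ (s y : ℂ) (B : ℝ), X0 * X1 * s = y → ‖y‖ ≤ B → ‖s‖ ≤ B / μ ^ 2 := by
    intro s y B h hB
    rw [le_div_iff₀ (by positivity)]
    calc ‖s‖ * μ ^ 2 = ‖s‖ * (μ * μ) := by ring
      _ ≤ ‖s‖ * (‖X0‖ * ‖X1‖) := by gcongr
      _ = ‖y‖ := by rw [← h, norm_mul, norm_mul, mul_comm]
      _ ≤ B := hB
  have hq : ‖X2 * X3‖ ≤ Kq * t ^ 2 := by
    have := hdiv (X2 * X3) e4 _ (by rw [← E4]; ring) h4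
    rw [hKq, div_mul_eq_mul_div]; exact this
  have hX01 : ‖X0 + X1‖ ≤ 8 * K := (norm_add_le _ _).trans (by linarith)
  have hp : ‖X2 + X3‖ ≤ Kp * t := by
    have := hdiv (X2 + X3) (e3 - (X0 + X1) * (X2 * X3)) ((K + 8 * K * Kq) * t)
      (by rw [← E3]; ring) (by
        refine (norm_sub_le _ _).trans ?_
        rw [norm_mul]
        have : ‖X0 + X1‖ * ‖X2 * X3‖ ≤ 8 * K * (Kq * t) := by
          gcongr; exact hq.trans (by gcongr)
        linarith)
    rw [hKp, div_mul_eq_mul_div]; exact this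
  have hroot : ∀ z : ℂ, (z - X2) * (z - X3) = 0 → ‖z‖ ≤ 4 * L * t := by
    intro z hz
    refine quartic_bound (a := -(X2 + X3)) (b := X2 * X3)
      (c := 0) (d := 0) (by linarith) ht (by linear_combination z ^ 2 * hz) ?_ ?_ ?_ ?_
    · rw [norm_neg]; exact hp.trans (by gcongr; linarith)
    · exact hq.trans (by gcongr; linarith)
    · simp; positivity
    · simp; positivity
  have hd2 : ‖X1 - X0‖ ^ 2 ≤ J * t := by
    have e : (X1 - X0) ^ 2 = (e1 ^ 2 - 4 * e2) - 2 * e1 * (X2 + X3) + (X2 + X3) ^ 2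
        + 4 * ((X0 + X1) * (X2 + X3) + X2 * X3) := by
      rw [← E1, ← E2]; ring
    rw [← norm_pow, e]
    have b1 : ‖2 * e1 * (X2 + X3)‖ ≤ 2 * K * (Kp * t) := by
      rw [norm_mul, norm_mul]; simp; gcongr
    have b2 : ‖(X2 + X3) ^ 2‖ ≤ Kp ^ 2 * t := by
      rw [norm_pow]
      calc ‖X2 + X3‖ ^ 2 ≤ (Kp * t) ^ 2 := by gcongr
        _ = Kp ^ 2 * t ^ 2 := by ring
        _ ≤ _ := by gcongr
    have b3 : ‖4 * ((X0 + X1) * (X2 + X3) + X2 * X3)‖ ≤ 4 * (8 * K * (Kp * t) + Kq * t) := by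
      rw [norm_mul]; simp only [Complex.norm_ofNat]
      gcongr
      refine (norm_add_le _ _).trans (add_le_add ?_ (hq.trans (by gcongr)))
      rw [norm_mul]; gcongr
    have := norm_add_le ((e1 ^ 2 - 4 * e2) - 2 * e1 * (X2 + X3) + (X2 + X3) ^ 2)
      (4 * ((X0 + X1) * (X2 + X3) + X2 * X3))
    have := norm_add_le ((e1 ^ 2 - 4 * e2) - 2 * e1 * (X2 + X3)) ((X2 + X3) ^ 2)
    have := norm_sub_le (e1 ^ 2 - 4 * e2) (2 * e1 * (X2 + X3))
    rw [hJ]; linarith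
  obtain ⟨s, hs, hs2⟩ := sign_choice (x 1) (x 0)
  have hx0n : μ ≤ ‖x 0‖ ^ 2 := by rw [hX0, norm_pow] at hX0l; exact hX0l
  have hx1 : ‖x 1 - s * x 0‖ ^ 2 ≤ J / μ * t := by
    rw [div_mul_eq_mul_div, le_div_iff₀ hμp]
    calc ‖x 1 - s * x 0‖ ^ 2 * μ ≤ ‖x 1 - s * x 0‖ ^ 2 * ‖x 0‖ ^ 2 := by gcongr
      _ = (‖x 0‖ * ‖x 1 - s * x 0‖) ^ 2 := by ring
      _ ≤ ‖X1 - X0‖ ^ 2 := by gcongr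
      _ ≤ _ := hd2
  have hMt : 0 ≤ M * t := by positivity
  have hJμ : 0 < J / μ := by positivity
  have hn : ‖(![0, x 1 - s * x 0, x 2, x 3] : Fin 4 → ℂ)‖ ^ 2 ≤ M * t := by
    refine norm_sq_le_of hMt fun i => ?_
    fin_cases i
    · simpa using hMt
    · exact hx1.trans (by gcongr; rw [hM]; linarith [show 0 < L by positivity])
    · have := hroot X2 (by ring)
      rw [hX2, norm_pow] at this
      exact this.trans (by gcongr; rw [hM]; linarith)
    · have := hroot X3 (by ring)
      rw [hX3, norm_pow] at this
      exact this.trans (by gcongr; rw [hM]; linarith)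
  have e : x = (x 0) • ![1, s, 0, 0] + ![0, x 1 - s * x 0, x 2, x 3] := by
    funext i; fin_cases i <;> simp; ring
  have hc1 : c0 ≤ ‖x 0‖ := Real.sqrt_le_iff.mpr ⟨norm_nonneg _, hx0n⟩
  have hc2 := norm_le_one_add_sq ‖x 0‖
  have hc3 := norm_le_one_add_sq ‖(![0, x 1 - s * x 0, x 2, x 3] : Fin 4 → ℂ)‖
  have := hR 0
  have hLt1 : M * t ≤ M := mul_le_of_le_one_right (by positivity) ht1
  have hb := hC (x 0) _ (![0, x 1 - s * x 0, x 2, x 3]) (good2 s hs) hc1 (by linarith) (by linarith)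
  rw [← e] at hb
  calc ‖NF F x‖ ≤ _ := hb
    _ ≤ C * (M * t) ^ (192 * m) := by
        gcongr; exact pow_sq_bound hn m
    _ = _ := by rw [mul_pow]; ring


section Curve
variable {R : Type*} [CommRing R]

/-- auxiliary curve polynomials -/
def cN (P t : R) : R := t ^ 3 - 3 * P * t + 2 * P
/-- auxiliary curve polynomials -/
def cD (P t : R) : R := 2 * t ^ 3 - 3 * t ^ 2 + P
/-- auxiliary curve polynomials -/
def cDel (P t : R) : R := t ^ 3 - 3 * t ^ 2 + 3 * P * t - P
/-- auxiliary curve polynomials -/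
def cEta (P t : R) : R := -3 * (t ^ 2 - 2 * P * t + P)
/-- auxiliary curve polynomials -/
def cT1 (P t : R) : R := t ^ 4 - 2 * t ^ 3 - P + 2 * P * t
/-- auxiliary curve polynomials -/
def cT2 (P t : R) : R := t ^ 4 - 4 * P * t ^ 3 + 6 * P * t ^ 2 - 4 * P * t + P ^ 2
/-- auxiliary curve polynomials -/
def cW (P t : R) : R := (2 * P - 1) * t ^ 6 - 6 * P * t ^ 5 + 15 * P * t ^ 4
  - 10 * P ^ 2 * t ^ 3 - 10 * P * t ^ 3 + 15 * P ^ 2 * t ^ 2 - 6 * P ^ 2 * t - P ^ 3 + 2 * P ^ 2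
/-- auxiliary curve polynomials -/
def cV (P t : R) : R := -2 * P * t ^ 7 + t ^ 7 + 7 * P * t ^ 6 - 21 * P * t ^ 5
  + 21 * P ^ 2 * t ^ 4 + 14 * P * t ^ 4 - 14 * P ^ 3 * t ^ 3 - 21 * P ^ 2 * t ^ 3
  + 21 * P ^ 3 * t ^ 2 - 7 * P ^ 3 * t - P ^ 4 + 2 * P ^ 3
/-- auxiliary curve polynomials -/
def cS (P k c t : R) : R := -3 * c * (cT1 P t * cT2 P t ^ 2) - k ^ 2 * (cD P t ^ 3 * cEta P t)
/-- auxiliary curve polynomials -/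
def cL (P k t : R) : R := 3 * k * (cN P t * cD P t * cDel P t)
/-- auxiliary curve polynomials -/
def cA (P k c t : R) : R := 3 * (cS P k c t * cW P t)
/-- auxiliary curve polynomials -/
def cZ (P k c t : R) : R := 9 * k * (cS P k c t * (t * (t - 1)) * cT2 P t ^ 3)
/-- auxiliary curve polynomials -/
def cE1 (P k t : R) : R := 2 * cL P k t
/-- auxiliary curve polynomials -/
def cE2 (P k c t : R) : R := cL P k t ^ 2 + cA P k c t
/-- auxiliary curve polynomials -/
def cE3 (P k c t : R) : R := -18 * k * (cS P k c t * cT1 P t ^ 2 * cV P t)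
/-- auxiliary curve polynomials -/
def cE4 (P k c t : R) : R := 9 * P * (P - 1) * (cS P k c t ^ 2 * cT1 P t ^ 3)
/-- auxiliary curve polynomials -/
def cU1 (P t : R) : R := 9 * t ^ 8 + 36 * P * t ^ 7 - 54 * t ^ 7 - 72 * P ^ 2 * t ^ 6
  - 54 * P * t ^ 6 + 216 * P ^ 2 * t ^ 5 + 414 * P * t ^ 5 - 990 * P ^ 2 * t ^ 4
  - 270 * P * t ^ 4 + 468 * P ^ 3 * t ^ 3 + 918 * P ^ 2 * t ^ 3 - 702 * P ^ 3 * t ^ 2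
  - 180 * P ^ 2 * t ^ 2 + 306 * P ^ 3 * t + 9 * P ^ 4 - 54 * P ^ 3
/-- auxiliary curve polynomials -/
def cU2 (P t : R) : R := 9 * t ^ 4 - 18 * t ^ 3 + 27 * t ^ 2 - 36 * P * t + 18 * P
/-- auxiliary curve polynomials -/
def cU3 (P t : R) : R := -6 * t ^ 4 + 12 * t ^ 3 - 9 * t ^ 2 + 6 * P * t - 3 * P

lemma id_del (P t : R) : cDel P t = cD P t - cN P t := by unfold cDel cD cN; ring
lemma id_eta (P t : R) : cEta P t = cD P t - 2 * cN P t := by unfold cEta cD cN; ring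
lemma id1 (P t : R) : cN P t ^ 4 - 2 * cN P t ^ 3 * cD P t - P * (cD P t ^ 3 * cEta P t)
    = -3 * (cT1 P t * cT2 P t ^ 2) := by unfold cN cD cEta cT1 cT2; ring
lemma id2 (P t : R) : cW P t ^ 2 - 4 * P * (P - 1) * cT1 P t ^ 3 = cT2 P t ^ 3 := by
  unfold cW cT1 cT2; ring
lemma id3 (P t : R) : 9 * cN P t ^ 2 * cDel P t ^ 2 - 3 * cD P t * cEta P t * cW P t
    = cT1 P t * cU1 P t := by unfold cN cDel cD cEta cW cT1 cU1; ring
lemma id4 (P t : R) : 9 * cN P t ^ 2 * cDel P t ^ 2 + 6 * cD P t * cEta P t * cW P t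
    = cT2 P t ^ 2 * cU2 P t := by unfold cN cDel cD cEta cW cT2 cU2; ring
lemma id5 (P t : R) : cN P t * cD P t * cDel P t * cW P t + 2 * (cT1 P t ^ 2 * cV P t)
    = t * (t - 1) * cT2 P t ^ 3 := by unfold cN cDel cD cW cT1 cT2 cV; ring
lemma id6 (P t : R) : 6 * cN P t * cDel P t * (t * (t - 1)) + cD P t ^ 2 * cEta P t
    = cT2 P t * cU3 P t := by unfold cN cDel cD cEta cT2 cU3; ring

lemma cE3_eq (P k c t : R) : cE3 P k c t = cL P k t * cA P k c t - cZ P k c t := by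
  unfold cE3 cL cA cZ
  linear_combination (-9 * k * cS P k c t) * id5 P t

lemma cE2_T1 (P k c t : R) : cE2 P k c t
    = cT1 P t * (k ^ 2 * cD P t ^ 2 * cU1 P t - 9 * c * cT2 P t ^ 2 * cW P t) := by
  unfold cE2 cA cL
  rw [cS]
  linear_combination (k ^ 2 * cD P t ^ 2) * id3 P t

lemma cS_eq (P k c t : R) : cS P k c t = c * (cN P t ^ 4 - 2 * cN P t ^ 3 * cD P t)
    - (c * P + k ^ 2) * (cD P t ^ 3 * cEta P t) := by
  unfold cS
  linear_combination (-c) * id1 P t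
end Curve

section CurveC
variable (P k c t : ℂ)

lemma c2_eq : cE2 P k c t - 3 * cE1 P k t ^ 2 / 8 = cT2 P t ^ 2 *
    (-(k ^ 2 * cD P t ^ 2 * cU2 P t) / 2 - 9 * c * cT1 P t * cW P t) := by
  unfold cE2 cE1 cA cL
  rw [cS]
  linear_combination (-(k ^ 2 * cD P t ^ 2) / 2) * id4 P t

lemma c3_eq : -cE3 P k c t + cE1 P k t * cE2 P k c t / 2 - cE1 P k t ^ 3 / 8 =
    cT2 P t ^ 3 * (9 * k * (cS P k c t * (t * (t - 1)))) := by
  rw [cE3_eq]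
  unfold cE2 cE1 cZ
  ring

lemma c4_eq : cE4 P k c t - cE1 P k t * cE3 P k c t / 4 + cE1 P k t ^ 2 * cE2 P k c t / 16
      - 3 * cE1 P k t ^ 4 / 256 =
    cT2 P t ^ 4 * ((-(k ^ 2 * cD P t ^ 2 * cU2 P t) / 2 - 9 * c * cT1 P t * cW P t) ^ 2 / 4
      + 9 * cS P k c t / 4 * (k ^ 2 * cD P t * cU3 P t + 3 * c * cT1 P t * cT2 P t)) := by
  have h2 := c2_eq P k c t
  have h6 : 2 * k * cL P k t * (t * (t - 1)) - cS P k c t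
      = cT2 P t * (k ^ 2 * cD P t * cU3 P t + 3 * c * cT1 P t * cT2 P t) := by
    unfold cL cS
    linear_combination (k ^ 2 * cD P t) * id6 P t
  have h : cE4 P k c t - cE1 P k t * cE3 P k c t / 4 + cE1 P k t ^ 2 * cE2 P k c t / 16
      - 3 * cE1 P k t ^ 4 / 256 = (cE2 P k c t - 3 * cE1 P k t ^ 2 / 8) ^ 2 / 4
      + 9 * cS P k c t / 4 * cT2 P t ^ 3 * (2 * k * cL P k t * (t * (t - 1)) - cS P k c t) := by
    rw [cE3_eq]
    unfold cE4 cE2 cE1 cA cZ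
    linear_combination (-9 / 4 * cS P k c t ^ 2) * id2 P t
  rw [h, h2, h6]; ring

/-- admissible parameters -/
structure GoodPar (P k c : ℂ) : Prop where
  hP : P ≠ 0
  hP1 : P - 1 ≠ 0
  hk : k ≠ 0
  hc : c ≠ 0
  h1 : c * P + k ^ 2 ≠ 0
  h2 : c * (P - 1) + k ^ 2 ≠ 0

variable {P k c t}

lemma ND_ne (g : GoodPar P k c) (hN : cN P t = 0) (hD : cD P t = 0) : False := by
  have he : cEta P t = 0 := by rw [id_eta, hN, hD]; ring
  have h1 : 2 * P * (t - 1) ^ 2 = 0 := by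
    unfold cN at hN; unfold cEta at he
    linear_combination hN + t * he / 3
  have h2 : t - 1 = 0 := by
    have := mul_eq_zero.mp h1
    rcases this with h | h
    · exact absurd h (mul_ne_zero two_ne_zero g.hP)
    · exact pow_eq_zero_iff (two_ne_zero) |>.mp h
  have ht : t = 1 := by linear_combination h2
  subst ht
  apply g.hP1
  unfold cD at hD
  linear_combination hD

lemma form_ne (g : GoodPar P k c) {a b : ℂ} (ha : a ≠ 0) (hb : b ≠ 0) (hab : b - a ≠ 0)
    (h : a * (cN P t ^ 4 - 2 * cN P t ^ 3 * cD P t) - b * (cD P t ^ 3 * cEta P t) = 0) :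
    cN P t ≠ 0 ∧ cD P t ≠ 0 ∧ cDel P t ≠ 0 := by
  rw [id_eta] at h
  have key1 : cD P t ≠ 0 := by
    intro hD
    rw [hD] at h
    have : a * cN P t ^ 4 = 0 := by linear_combination h
    exact ND_ne g (by simpa [ha] using this) hD
  have key2 : cN P t ≠ 0 := by
    intro hN
    rw [hN] at h
    have : b * cD P t ^ 4 = 0 := by linear_combination -h
    exact key1 (by simpa [hb] using this)
  refine ⟨key2, key1, fun hd => ?_⟩
  rw [id_del] at hd
  have hD : cD P t = cN P t := by linear_combination hd
  rw [hD] at h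
  have : (b - a) * cN P t ^ 4 = 0 := by linear_combination h
  exact key2 (by simpa [hab] using this)

lemma S_ne (g : GoodPar P k c) (h : cS P k c t = 0) :
    cN P t ≠ 0 ∧ cD P t ≠ 0 ∧ cDel P t ≠ 0 := by
  rw [cS_eq] at h
  refine form_ne g g.hc g.h1 ?_ h
  have := g.h2
  intro h0; apply this; linear_combination h0

lemma T_ne (g : GoodPar P k c) (h : cT1 P t * cT2 P t ^ 2 = 0) :
    cN P t ≠ 0 ∧ cD P t ≠ 0 ∧ cDel P t ≠ 0 := by
  have h1 := id1 P t
  rw [h] at h1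
  exact form_ne g one_ne_zero g.hP g.hP1 (by linear_combination h1)

lemma ST_ne (g : GoodPar P k c) (h : cS P k c t = 0) : cT1 P t * cT2 P t ^ 2 ≠ 0 := by
  intro hT
  obtain ⟨hN, hD, hDel⟩ := T_ne g hT
  have h1 := id1 P t
  rw [cS, hT] at h
  rw [hT] at h1
  have he : k ^ 2 * (cD P t ^ 3 * cEta P t) = 0 := by linear_combination -h
  have he : cEta P t = 0 := by simpa [g.hk, hD] using he
  rw [he] at h1
  have e2 := id_eta P t
  rw [he] at e2
  have : cN P t ^ 4 = 0 := by linear_combination -h1 / 3 + 2 / 3 * cN P t ^ 3 * e2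
  exact hN (by simpa using this)

lemma TT_ne (g : GoodPar P k c) (h1 : cT1 P t = 0) (h2 : cT2 P t = 0) : False := by
  obtain ⟨hN, hD, hDel⟩ := T_ne g (t := t) (by rw [h1]; ring)
  have h3 := id3 P t
  have h4 := id4 P t
  rw [h1] at h3
  rw [h2] at h4
  have : cN P t ^ 2 * cDel P t ^ 2 = 0 := by linear_combination (2 * h3 + h4) / 27
  simp [hN, hDel] at this

lemma L_ne (g : GoodPar P k c) (h : cN P t ≠ 0 ∧ cD P t ≠ 0 ∧ cDel P t ≠ 0) : cL P k t ≠ 0 := by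
  unfold cL
  obtain ⟨h1, h2, h3⟩ := h
  simp [h1, h2, h3, g.hk]
end CurveC


open Filter Topology in
lemma mult_le_of_bound {H B : Polynomial ℂ} (hH : H ≠ 0) (t0 : ℂ) (C : ℝ)
    (h : ∀ᶠ t in 𝓝 t0, ‖H.eval t‖ ≤ C * ‖B.eval t‖) :
    B.rootMultiplicity t0 ≤ H.rootMultiplicity t0 := by
  by_contra hlt
  push Not at hlt
  obtain ⟨H1, hH1, hn⟩ := Polynomial.exists_eq_pow_rootMultiplicity_mul_and_not_dvd H hH t0
  obtain ⟨B1, hB1⟩ := Polynomial.pow_rootMultiplicity_dvd B t0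
  set a := H.rootMultiplicity t0
  set b := B.rootMultiplicity t0
  have hn0 : H1.eval t0 ≠ 0 := by
    intro h0; exact hn (Polynomial.dvd_iff_isRoot.mpr h0)
  have h1 : ∀ᶠ t in 𝓝[≠] t0, ‖H1.eval t‖ ≤ C * ‖(t - t0) ^ (b - a) * B1.eval t‖ := by
    filter_upwards [h.filter_mono nhdsWithin_le_nhds, self_mem_nhdsWithin] with t ht hne
    have hp : 0 < ‖(t - t0) ^ a‖ := norm_pos_iff.mpr (pow_ne_zero _ (sub_ne_zero.mpr hne))
    have e1 : H.eval t = (t - t0) ^ a * H1.eval t := by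
      conv_lhs => rw [hH1]
      simp
    have e2 : B.eval t = (t - t0) ^ a * ((t - t0) ^ (b - a) * B1.eval t) := by
      conv_lhs => rw [hB1]
      rw [← mul_assoc, ← pow_add, Nat.add_sub_cancel' hlt.le]
      simp
    rw [e1, e2, norm_mul, norm_mul ((t - t0) ^ a)] at ht
    have : ‖(t - t0) ^ a‖ * ‖H1.eval t‖
      ≤ ‖(t - t0) ^ a‖ * (C * ‖(t - t0) ^ (b - a) * B1.eval t‖) := by linarith
    exact le_of_mul_le_mul_left this hp
  have l1 : Tendsto (fun t => ‖H1.eval t‖) (𝓝[≠] t0) (𝓝 ‖H1.eval t0‖) :=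
    (H1.continuous.norm.tendsto t0).mono_left nhdsWithin_le_nhds
  have l2 : Tendsto (fun t => C * ‖(t - t0) ^ (b - a) * B1.eval t‖) (𝓝[≠] t0) (𝓝 0) := by
    have hc : Continuous (fun t => C * ‖(t - t0) ^ (b - a) * B1.eval t‖) := by fun_prop
    have := (hc.tendsto t0).mono_left (nhdsWithin_le_nhds (s := {t0}ᶜ))
    have hba : b - a ≠ 0 := by omega
    simpa [hba] using this
  have := le_of_tendsto_of_tendsto l1 l2 h1
  exact hn0 (norm_le_zero_iff.mp this)

open Filter Topology in
lemma dvd_of_bound {H B : Polynomial ℂ} (hB : B ≠ 0)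
    (h : ∀ t0, B.eval t0 = 0 → ∃ C : ℝ, ∀ᶠ t in 𝓝 t0, ‖H.eval t‖ ≤ C * ‖B.eval t‖) : B ∣ H := by
  by_cases hH : H = 0
  · rw [hH]; exact dvd_zero _
  refine (IsAlgClosed.splits B).dvd_of_roots_le_roots hB ?_
  rw [Multiset.le_iff_count]
  intro t0
  rw [Polynomial.count_roots, Polynomial.count_roots]
  by_cases h0 : B.eval t0 = 0
  · obtain ⟨C, hC⟩ := h t0 h0
    exact mult_le_of_bound hH t0 C hC
  · rw [Polynomial.rootMultiplicity_eq_zero h0]; exact Nat.zero_le _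

lemma poly_growth (p : Polynomial ℂ) {n : ℕ} (hn : p.natDegree ≤ n) :
    ∃ K : ℝ, 0 ≤ K ∧ ∀ t : ℂ, 1 ≤ ‖t‖ → ‖p.eval t‖ ≤ K * ‖t‖ ^ n := by
  refine ⟨∑ i ∈ Finset.range (p.natDegree + 1), ‖p.coeff i‖, by positivity, fun t ht => ?_⟩
  rw [Polynomial.eval_eq_sum_range, Finset.sum_mul]
  refine (norm_sum_le _ _).trans (Finset.sum_le_sum fun i hi => ?_)
  rw [norm_mul, norm_pow]
  gcongr
  rw [Finset.mem_range] at hi; omega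

open Filter Asymptotics Bornology in
lemma natDegree_le_of_growth (p : Polynomial ℂ) (n : ℕ) (C : ℝ)
    (h : ∀ t : ℂ, 1 ≤ ‖t‖ → ‖p.eval t‖ ≤ C * ‖t‖ ^ n) : p.natDegree ≤ n := by
  by_contra hlt
  push Not at hlt
  have hp : p ≠ 0 := by rintro rfl; simp at hlt
  have h1 : (fun t => (Polynomial.X ^ n : Polynomial ℂ).eval t) =o[cobounded ℂ] (fun t => p.eval t) := by
    apply Polynomial.isLittleO_cobounded_of_degree_lt
    rw [Polynomial.degree_X_pow, Polynomial.degree_eq_natDegree hp]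
    exact_mod_cast hlt
  have hev : ∀ᶠ t : ℂ in cobounded ℂ, 1 ≤ ‖t‖ :=
    tendsto_norm_cobounded_atTop.eventually (eventually_ge_atTop 1)
  have h2 : (fun t => p.eval t) =O[cobounded ℂ]
      (fun t => (Polynomial.X ^ n : Polynomial ℂ).eval t) := by
    refine IsBigO.of_bound C ?_
    filter_upwards [hev] with t ht
    simpa using h t ht
  have h3 := h1.trans_isBigO h2
  have h4 := h3.bound (c := 1 / 2) (by norm_num)
  obtain ⟨t, ht, ht1⟩ := (h4.and hev).exists
  have h5 : 0 < ‖t‖ ^ n := by positivity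
  simp only [Polynomial.eval_pow, Polynomial.eval_X, norm_pow] at ht
  linarith


section Local
open Filter Topology

lemma ev_le {q : ℂ → ℂ} (hq : Continuous q) (t0 : ℂ) : ∀ᶠ t in 𝓝 t0, ‖q t‖ ≤ ‖q t0‖ + 1 := by
  filter_upwards [(hq.norm.tendsto t0).eventually (gt_mem_nhds (lt_add_one _))] with t ht
  exact ht.le

lemma ev_ge {q : ℂ → ℂ} (hq : Continuous q) {t0 : ℂ} (h0 : q t0 ≠ 0) :
    ∀ᶠ t in 𝓝 t0, ‖q t0‖ / 2 ≤ ‖q t‖ := by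
  filter_upwards [(hq.norm.tendsto t0).eventually
    (lt_mem_nhds (half_lt_self (norm_pos_iff.mpr h0)))] with t ht
  exact ht.le

variable {P k c : ℂ}

lemma cont_T1 : Continuous (fun t : ℂ => cT1 P t) := by unfold cT1; fun_prop
lemma cont_T2 : Continuous (fun t : ℂ => cT2 P t) := by unfold cT2; fun_prop
lemma cont_S : Continuous (fun t : ℂ => cS P k c t) := by
  unfold cS cT1 cT2 cD cEta; fun_prop
lemma cont_D : Continuous (fun t : ℂ => cD P t) := by unfold cD; fun_prop
lemma cont_W : Continuous (fun t : ℂ => cW P t) := by unfold cW; fun_prop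
lemma cont_V : Continuous (fun t : ℂ => cV P t) := by unfold cV; fun_prop
lemma cont_U1 : Continuous (fun t : ℂ => cU1 P t) := by unfold cU1; fun_prop
lemma cont_U2 : Continuous (fun t : ℂ => cU2 P t) := by unfold cU2; fun_prop
lemma cont_U3 : Continuous (fun t : ℂ => cU3 P t) := by unfold cU3; fun_prop
lemma cont_L : Continuous (fun t : ℂ => cL P k t) := by
  unfold cL cN cD cDel; fun_prop
lemma cont_E1 : Continuous (fun t : ℂ => cE1 P k t) := by
  have := cont_L (P := P) (k := k)
  unfold cE1; fun_prop
lemma cont_E2 : Continuous (fun t : ℂ => cE2 P k c t) := by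
  have := cont_L (P := P) (k := k)
  have := cont_S (P := P) (k := k) (c := c)
  have := cont_W (P := P)
  unfold cE2 cA; fun_prop

lemma fac_le {y T q : ℂ} {n : ℕ} {K : ℝ} (h : y = T ^ n * q) (hq : ‖q‖ ≤ K) :
    ‖y‖ ≤ K * ‖T‖ ^ n := by
  rw [h, norm_mul, norm_pow, mul_comm]; gcongr

lemma transfer {T q : ℂ} {δ C v : ℝ} {n : ℕ} (hC : 0 ≤ C) (hδ : 0 < δ) (hq : δ ≤ ‖q‖)
    (hv : v ≤ C * ‖T‖ ^ n) : v ≤ C * (δ⁻¹) ^ n * ‖T * q‖ ^ n := by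
  refine hv.trans ?_
  rw [mul_assoc, ← mul_pow]
  gcongr
  rw [norm_mul, inv_mul_eq_div, le_div_iff₀ hδ]
  gcongr

variable {F G : MvPolynomial (Fin 4) ℂ} {d m : ℕ}

lemma exK (a b c d : ℝ) : ∃ K : ℝ, 1 ≤ K ∧ a ≤ K ∧ b ≤ K ∧ c ≤ K ∧ d ≤ K :=
  ⟨max 1 (max a (max b (max c d))), by simp, by simp, by simp, by simp, by simp⟩

lemma local_T1 (g : GoodPar P k c) (hF : F.IsHomogeneous d)
    (hv : ∀ v ∈ F4Config, vanishesToOrder F v m)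
    (hG : ∀ x e1 e2 e3 e4, IsES x e1 e2 e3 e4 → NF F x = eval ![e1, e2, e3, e4] G)
    {t0 : ℂ} (h0 : cT1 P t0 = 0) : ∃ C : ℝ, ∀ᶠ t in 𝓝 t0,
      ‖eval ![cE1 P k t, cE2 P k c t, cE3 P k c t, cE4 P k c t] G‖ ≤
        C * ‖cS P k c t * cT1 P t * cT2 P t ^ 2‖ ^ (192 * m) := by
  have hT2 : cT2 P t0 ≠ 0 := fun h => TT_ne g h0 h
  have hS : cS P k c t0 ≠ 0 := fun h => ST_ne g h (by rw [h0]; ring)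
  have hE1 : cE1 P k t0 ≠ 0 := mul_ne_zero two_ne_zero (L_ne g (T_ne g (by rw [h0]; ring)))
  have ct1 := cont_T1 (P := P)
  have ct2 := cont_T2 (P := P)
  have cs := cont_S (P := P) (k := k) (c := c)
  have cd := cont_D (P := P)
  have cw := cont_W (P := P)
  have cv := cont_V (P := P)
  have cu1 := cont_U1 (P := P)
  have ce1 := cont_E1 (P := P) (k := k)
  have q2 : Continuous fun t : ℂ =>
    k ^ 2 * cD P t ^ 2 * cU1 P t - 9 * c * cT2 P t ^ 2 * cW P t := by fun_prop
  have q3 : Continuous fun t : ℂ => -18 * k * (cS P k c t * cV P t) := by fun_prop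
  have q4 : Continuous fun t : ℂ => 9 * P * (P - 1) * cS P k c t ^ 2 := by fun_prop
  have q5 : Continuous fun t : ℂ => cS P k c t * cT2 P t ^ 2 := by fun_prop
  have h5 : cS P k c t0 * cT2 P t0 ^ 2 ≠ 0 := mul_ne_zero hS (pow_ne_zero _ hT2)
  obtain ⟨K, hK, k1, k2, k3, k4⟩ := exK (‖cE1 P k t0‖ + 1)
      (‖k ^ 2 * cD P t0 ^ 2 * cU1 P t0 - 9 * c * cT2 P t0 ^ 2 * cW P t0‖ + 1)
      (‖-18 * k * (cS P k c t0 * cV P t0)‖ + 1) (‖9 * P * (P - 1) * cS P k c t0 ^ 2‖ + 1)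
  obtain ⟨C, hC0, hC⟩ := G_T1 hF hv hG (‖cE1 P k t0‖ / 2) K
    (half_pos (norm_pos_iff.mpr hE1)) hK
  refine ⟨C * ((‖cS P k c t0 * cT2 P t0 ^ 2‖ / 2)⁻¹) ^ (192 * m), ?_⟩
  filter_upwards [ev_le ct1 t0, ev_le ce1 t0, ev_ge ce1 hE1, ev_le q2 t0, ev_le q3 t0,
    ev_le q4 t0, ev_ge q5 h5] with t a1 a2 a3 a4 a5 a6 a7
  rw [h0, norm_zero, zero_add] at a1
  have := hC (cE1 P k t) (cE2 P k c t) (cE3 P k c t) (cE4 P k c t)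
    ‖cT1 P t‖ (norm_nonneg _) a1 a3 (a2.trans k1)
    (by simpa using fac_le (n := 1) (by rw [pow_one]; exact cE2_T1 P k c t) (a4.trans k2))
    (fac_le (by unfold cE3; ring) (a5.trans k3))
    (fac_le (by unfold cE4; ring) (a6.trans k4))
  have h := transfer hC0 (half_pos (norm_pos_iff.mpr h5)) a7 this
  rw [show cS P k c t * cT1 P t * cT2 P t ^ 2
    = cT1 P t * (cS P k c t * cT2 P t ^ 2) by ring]
  exact h

lemma local_T2 (g : GoodPar P k c) (hF : F.IsHomogeneous d)
    (hv : ∀ v ∈ F4Config, vanishesToOrder F v m)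
    (hG : ∀ x e1 e2 e3 e4, IsES x e1 e2 e3 e4 → NF F x = eval ![e1, e2, e3, e4] G)
    {t0 : ℂ} (h0 : cT2 P t0 = 0) : ∃ C : ℝ, ∀ᶠ t in 𝓝 t0,
      ‖eval ![cE1 P k t, cE2 P k c t, cE3 P k c t, cE4 P k c t] G‖ ≤
        C * ‖cS P k c t * cT1 P t * cT2 P t ^ 2‖ ^ (192 * m) := by
  have hT1 : cT1 P t0 ≠ 0 := fun h => TT_ne g h h0
  have hS : cS P k c t0 ≠ 0 := fun h => ST_ne g h (by rw [h0]; ring)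
  have hE1 : cE1 P k t0 ≠ 0 := mul_ne_zero two_ne_zero (L_ne g (T_ne g (by rw [h0]; ring)))
  have ct1 := cont_T1 (P := P)
  have ct2 := cont_T2 (P := P)
  have cs := cont_S (P := P) (k := k) (c := c)
  have cd := cont_D (P := P)
  have cw := cont_W (P := P)
  have cu2 := cont_U2 (P := P)
  have cu3 := cont_U3 (P := P)
  have ce1 := cont_E1 (P := P) (k := k)
  have q2 : Continuous fun t : ℂ =>
    -(k ^ 2 * cD P t ^ 2 * cU2 P t) / 2 - 9 * c * cT1 P t * cW P t := by fun_prop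
  have q3 : Continuous fun t : ℂ => 9 * k * (cS P k c t * (t * (t - 1))) := by fun_prop
  have q4 : Continuous fun t : ℂ =>
    (-(k ^ 2 * cD P t ^ 2 * cU2 P t) / 2 - 9 * c * cT1 P t * cW P t) ^ 2 / 4
      + 9 * cS P k c t / 4 * (k ^ 2 * cD P t * cU3 P t + 3 * c * cT1 P t * cT2 P t) := by
    fun_prop
  have q5 : Continuous fun t : ℂ => cS P k c t * cT1 P t := by fun_prop
  have h5 : cS P k c t0 * cT1 P t0 ≠ 0 := mul_ne_zero hS hT1
  obtain ⟨K, hK, k1, k2, k3, k4⟩ := exK (‖cE1 P k t0‖ + 1)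
      (‖-(k ^ 2 * cD P t0 ^ 2 * cU2 P t0) / 2 - 9 * c * cT1 P t0 * cW P t0‖ + 1)
      (‖9 * k * (cS P k c t0 * (t0 * (t0 - 1)))‖ + 1)
      (‖(-(k ^ 2 * cD P t0 ^ 2 * cU2 P t0) / 2 - 9 * c * cT1 P t0 * cW P t0) ^ 2 / 4
      + 9 * cS P k c t0 / 4 * (k ^ 2 * cD P t0 * cU3 P t0 + 3 * c * cT1 P t0 * cT2 P t0)‖ + 1)
  obtain ⟨C, hC0, hC⟩ := G_T2 hF hv hG (‖cE1 P k t0‖ / 2) K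
    (half_pos (norm_pos_iff.mpr hE1)) hK
  refine ⟨C * ((‖cS P k c t0 * cT1 P t0‖ / 2)⁻¹) ^ (192 * m), ?_⟩
  filter_upwards [ev_le ct2 t0, ev_le ce1 t0, ev_ge ce1 hE1, ev_le q2 t0, ev_le q3 t0,
    ev_le q4 t0, ev_ge q5 h5] with t a1 a2 a3 a4 a5 a6 a7
  rw [h0, norm_zero, zero_add] at a1
  have := hC (cE1 P k t) (cE2 P k c t) (cE3 P k c t) (cE4 P k c t)
    ‖cT2 P t‖ (norm_nonneg _) a1 a3 (a2.trans k1)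
    (fac_le (c2_eq P k c t) (a4.trans k2))
    (fac_le (c3_eq P k c t) (a5.trans k3))
    (fac_le (c4_eq P k c t) (a6.trans k4))
  rw [show 384 * m = 2 * (192 * m) by ring, pow_mul, ← norm_pow] at this
  have h := transfer hC0 (half_pos (norm_pos_iff.mpr h5)) a7 this
  rw [show cS P k c t * cT1 P t * cT2 P t ^ 2
    = cT2 P t ^ 2 * (cS P k c t * cT1 P t) by ring]
  exact h

lemma local_S (g : GoodPar P k c) (hF : F.IsHomogeneous d)
    (hv : ∀ v ∈ F4Config, vanishesToOrder F v m)
    (hG : ∀ x e1 e2 e3 e4, IsES x e1 e2 e3 e4 → NF F x = eval ![e1, e2, e3, e4] G)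
    {t0 : ℂ} (h0 : cS P k c t0 = 0) : ∃ C : ℝ, ∀ᶠ t in 𝓝 t0,
      ‖eval ![cE1 P k t, cE2 P k c t, cE3 P k c t, cE4 P k c t] G‖ ≤
        C * ‖cS P k c t * cT1 P t * cT2 P t ^ 2‖ ^ (192 * m) := by
  have h5 := ST_ne g h0
  have hL := L_ne g (S_ne g h0)
  have hE2 : cE2 P k c t0 ≠ 0 := by
    unfold cE2 cA; rw [h0]; simpa using hL
  have ct1 := cont_T1 (P := P)
  have ct2 := cont_T2 (P := P)
  have cs := cont_S (P := P) (k := k) (c := c)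
  have cw := cont_W (P := P)
  have cv := cont_V (P := P)
  have ce1 := cont_E1 (P := P) (k := k)
  have ce2 := cont_E2 (P := P) (k := k) (c := c)
  have q3 : Continuous fun t : ℂ => -18 * k * (cT1 P t ^ 2 * cV P t) := by fun_prop
  have q4 : Continuous fun t : ℂ => 9 * P * (P - 1) * cT1 P t ^ 3 := by fun_prop
  have q6 : Continuous fun t : ℂ => -12 * cW P t := by fun_prop
  have q5 : Continuous fun t : ℂ => cT1 P t * cT2 P t ^ 2 := by fun_prop
  obtain ⟨K0, hK0, k1, k2, k3, k4⟩ := exK (‖cE1 P k t0‖ + 1) (‖cE2 P k c t0‖ + 1)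
      (‖-18 * k * (cT1 P t0 ^ 2 * cV P t0)‖ + 1) (‖9 * P * (P - 1) * cT1 P t0 ^ 3‖ + 1)
  obtain ⟨K, hK, j1, j2, -, -⟩ := exK K0 (‖-12 * cW P t0‖ + 1) 0 0
  obtain ⟨C, hC0, hC⟩ := G_S hF hv hG (‖cE2 P k c t0‖ / 2) K
    (half_pos (norm_pos_iff.mpr hE2)) hK
  refine ⟨C * ((‖cT1 P t0 * cT2 P t0 ^ 2‖ / 2)⁻¹) ^ (192 * m), ?_⟩
  filter_upwards [ev_le cs t0, ev_le ce1 t0, ev_ge ce2 hE2, ev_le ce2 t0, ev_le q3 t0,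
    ev_le q4 t0, ev_le q6 t0, ev_ge q5 h5] with t a1 a2 a3 a4 a5 a6 a7 a8
  rw [h0, norm_zero, zero_add] at a1
  have := hC (cE1 P k t) (cE2 P k c t) (cE3 P k c t) (cE4 P k c t)
    ‖cS P k c t‖ (norm_nonneg _) a1 ((a2.trans k1).trans j1) a3 ((a4.trans k2).trans j1)
    (by simpa using fac_le (y := cE3 P k c t) (T := cS P k c t) (n := 1)
          (by rw [pow_one]; unfold cE3; ring) ((a5.trans k3).trans j1))
    (fac_le (by unfold cE4; ring) ((a6.trans k4).trans j1))
    (by simpa using fac_le (y := cE1 P k t ^ 2 - 4 * cE2 P k c t) (T := cS P k c t) (n := 1)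
          (by rw [pow_one]; unfold cE1 cE2 cA; ring) (a7.trans j2))
  have h := transfer hC0 (half_pos (norm_pos_iff.mpr h5)) a8 this
  rw [show cS P k c t * cT1 P t * cT2 P t ^ 2
    = cS P k c t * (cT1 P t * cT2 P t ^ 2) by ring]
  exact h
end Local


set_option linter.unusedSimpArgs false
section Global
open Filter Topology
variable {P k c : ℂ}

lemma dN : (cN (Polynomial.C P) Polynomial.X).natDegree ≤ 3 := by unfold cN; compute_degree
lemma dD : (cD (Polynomial.C P) Polynomial.X).natDegree ≤ 3 := by unfold cD; compute_degree
lemma dDel : (cDel (Polynomial.C P) Polynomial.X).natDegree ≤ 3 := by unfold cDel; compute_degree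
lemma dEta : (cEta (Polynomial.C P) Polynomial.X).natDegree ≤ 2 := by unfold cEta; compute_degree
lemma dT1 : (cT1 (Polynomial.C P) Polynomial.X).natDegree = 4 := by unfold cT1; compute_degree!
lemma dT2 : (cT2 (Polynomial.C P) Polynomial.X).natDegree = 4 := by unfold cT2; compute_degree!
lemma dW : (cW (Polynomial.C P) Polynomial.X).natDegree ≤ 6 := by unfold cW; compute_degree
lemma dV : (cV (Polynomial.C P) Polynomial.X).natDegree ≤ 7 := by unfold cV; compute_degree

lemma pmul_le {p q : Polynomial ℂ} {a b n : ℕ} (hp : p.natDegree ≤ a) (hq : q.natDegree ≤ b)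
    (hn : a + b ≤ n) : (p * q).natDegree ≤ n :=
  (Polynomial.natDegree_mul_le_of_le hp hq).trans hn

lemma ppow_le {p : Polynomial ℂ} {a n : ℕ} (r : ℕ) (hp : p.natDegree ≤ a)
    (hn : r * a ≤ n) : (p ^ r).natDegree ≤ n :=
  (Polynomial.natDegree_pow_le_of_le r hp).trans hn

lemma pcoef_le (a : ℂ) {p : Polynomial ℂ} {n : ℕ} (hp : p.natDegree ≤ n) :
    (Polynomial.C a * p).natDegree ≤ n :=
  (Polynomial.natDegree_C_mul_le a p).trans hp

lemma dDE : (cD (Polynomial.C P) Polynomial.X ^ 3 * cEta (Polynomial.C P) Polynomial.X).natDegree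
    ≤ 11 := pmul_le (ppow_le 3 dD le_rfl) dEta le_rfl

lemma T1_ne : cT1 (Polynomial.C P) Polynomial.X ≠ 0 := by
  intro h; have := dT1 (P := P); rw [h] at this; simp at this
lemma T2_ne : cT2 (Polynomial.C P) Polynomial.X ≠ 0 := by
  intro h; have := dT2 (P := P); rw [h] at this; simp at this

lemma dTT : (cT1 (Polynomial.C P) Polynomial.X * cT2 (Polynomial.C P) Polynomial.X ^ 2).natDegree
    = 12 := by
  rw [Polynomial.natDegree_mul T1_ne (pow_ne_zero _ T2_ne), Polynomial.natDegree_pow, dT1, dT2]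

lemma cS_C : cS (Polynomial.C P) (Polynomial.C k) (Polynomial.C c) Polynomial.X =
    Polynomial.C (-3 * c) * (cT1 (Polynomial.C P) Polynomial.X * cT2 (Polynomial.C P) Polynomial.X ^ 2)
    - Polynomial.C (k ^ 2) *
      (cD (Polynomial.C P) Polynomial.X ^ 3 * cEta (Polynomial.C P) Polynomial.X) := by
  unfold cS
  simp only [map_mul, map_neg, map_ofNat, map_pow, map_sub, map_one]

lemma dS (hc : c ≠ 0) :
    (cS (Polynomial.C P) (Polynomial.C k) (Polynomial.C c) Polynomial.X).natDegree = 12 := by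
  have h1 : (Polynomial.C (-3 * c) * (cT1 (Polynomial.C P) Polynomial.X *
      cT2 (Polynomial.C P) Polynomial.X ^ 2)).natDegree = 12 := by
    rw [Polynomial.natDegree_C_mul (by simpa using hc), dTT]
  rw [cS_C, Polynomial.natDegree_sub_eq_left_of_natDegree_lt, h1]
  rw [h1]
  exact lt_of_le_of_lt (pcoef_le _ dDE) (by norm_num)

/-- the boundary polynomial of the curve -/
noncomputable def pB (P k c : ℂ) : Polynomial ℂ :=
  cS (Polynomial.C P) (Polynomial.C k) (Polynomial.C c) Polynomial.X *
    cT1 (Polynomial.C P) Polynomial.X * cT2 (Polynomial.C P) Polynomial.X ^ 2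

lemma dB (hc : c ≠ 0) : (pB P k c).natDegree = 24 := by
  have hS : cS (Polynomial.C P) (Polynomial.C k) (Polynomial.C c) Polynomial.X ≠ 0 := by
    intro h; have := dS (P := P) (k := k) hc; rw [h] at this; simp at this
  unfold pB
  rw [mul_assoc, Polynomial.natDegree_mul hS (mul_ne_zero T1_ne (pow_ne_zero _ T2_ne)), dTT, dS hc]

lemma eval_pB (t : ℂ) : (pB P k c).eval t = cS P k c t * cT1 P t * cT2 P t ^ 2 := by
  simp [pB, cS, cT1, cT2, cD, cEta]

/-- the curve in polynomial form -/
noncomputable def pE (P k c : ℂ) : Fin 4 → Polynomial ℂ :=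
  ![cE1 (Polynomial.C P) (Polynomial.C k) Polynomial.X,
    cE2 (Polynomial.C P) (Polynomial.C k) (Polynomial.C c) Polynomial.X,
    cE3 (Polynomial.C P) (Polynomial.C k) (Polynomial.C c) Polynomial.X,
    cE4 (Polynomial.C P) (Polynomial.C k) (Polynomial.C c) Polynomial.X]

lemma eval_cS (t : ℂ) : (cS (Polynomial.C P) (Polynomial.C k) (Polynomial.C c)
    Polynomial.X).eval t = cS P k c t := by
  simp [cS, cT1, cT2, cD, cEta]
lemma eval_cL (t : ℂ) : (cL (Polynomial.C P) (Polynomial.C k)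
    Polynomial.X).eval t = cL P k t := by
  simp [cL, cN, cD, cDel]

lemma eval_pE (t : ℂ) (i : Fin 4) : (pE P k c i).eval t =
    ![cE1 P k t, cE2 P k c t, cE3 P k c t, cE4 P k c t] i := by
  fin_cases i
  · simp [pE, cE1, eval_cL]
  · simp [pE, cE2, cA, eval_cL, eval_cS, cW]
  · simp [pE, cE3, eval_cS, cT1, cV]
  · simp [pE, cE4, eval_cS, cT1]

lemma eval_aeval (G : MvPolynomial (Fin 4) ℂ) (f : Fin 4 → Polynomial ℂ) (t : ℂ) :
    (aeval f G).eval t = eval (fun i => (f i).eval t) G := by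
  induction G using MvPolynomial.induction_on with
  | C a => simp
  | add p q hp hq => simp [hp, hq]
  | mul_X p i hp => simp [hp]

lemma dL : (cL (Polynomial.C P) (Polynomial.C k) Polynomial.X).natDegree ≤ 9 := by
  have : cL (Polynomial.C P) (Polynomial.C k) Polynomial.X = Polynomial.C (3 * k) *
      (cN (Polynomial.C P) Polynomial.X * cD (Polynomial.C P) Polynomial.X *
        cDel (Polynomial.C P) Polynomial.X) := by unfold cL; simp only [map_mul, map_neg, map_ofNat, map_pow, map_sub, map_one]
  rw [this]
  exact pcoef_le _ (pmul_le (pmul_le dN dD le_rfl) dDel le_rfl)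

lemma dE1 : (cE1 (Polynomial.C P) (Polynomial.C k) Polynomial.X).natDegree ≤ 9 := by
  have : cE1 (Polynomial.C P) (Polynomial.C k) Polynomial.X = Polynomial.C 2 *
      cL (Polynomial.C P) (Polynomial.C k) Polynomial.X := by
    unfold cE1; simp only [map_mul, map_neg, map_ofNat, map_pow, map_sub, map_one]
  rw [this]
  exact pcoef_le _ dL

lemma dE2 (hc : c ≠ 0) : (cE2 (Polynomial.C P) (Polynomial.C k) (Polynomial.C c)
    Polynomial.X).natDegree ≤ 18 := by
  have : cE2 (Polynomial.C P) (Polynomial.C k) (Polynomial.C c) Polynomial.X =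
      cL (Polynomial.C P) (Polynomial.C k) Polynomial.X ^ 2 + Polynomial.C 3 *
        (cS (Polynomial.C P) (Polynomial.C k) (Polynomial.C c) Polynomial.X *
          cW (Polynomial.C P) Polynomial.X) := by
    unfold cE2 cA; simp only [map_mul, map_neg, map_ofNat, map_pow, map_sub, map_one]
  rw [this]
  exact Polynomial.natDegree_add_le_of_degree_le (ppow_le 2 dL le_rfl)
    (pcoef_le _ (pmul_le (dS hc).le dW le_rfl))

lemma dE3 (hc : c ≠ 0) : (cE3 (Polynomial.C P) (Polynomial.C k) (Polynomial.C c)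
    Polynomial.X).natDegree ≤ 27 := by
  have : cE3 (Polynomial.C P) (Polynomial.C k) (Polynomial.C c) Polynomial.X =
      Polynomial.C (-18 * k) *
        (cS (Polynomial.C P) (Polynomial.C k) (Polynomial.C c) Polynomial.X *
          cT1 (Polynomial.C P) Polynomial.X ^ 2 * cV (Polynomial.C P) Polynomial.X) := by
    unfold cE3; simp only [map_mul, map_neg, map_ofNat, map_pow, map_sub, map_one]
  rw [this]
  exact pcoef_le _ (pmul_le (pmul_le (dS hc).le (ppow_le 2 dT1.le le_rfl) le_rfl) dV le_rfl)

lemma dE4 (hc : c ≠ 0) : (cE4 (Polynomial.C P) (Polynomial.C k) (Polynomial.C c)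
    Polynomial.X).natDegree ≤ 36 := by
  have : cE4 (Polynomial.C P) (Polynomial.C k) (Polynomial.C c) Polynomial.X =
      Polynomial.C (9 * P * (P - 1)) *
        (cS (Polynomial.C P) (Polynomial.C k) (Polynomial.C c) Polynomial.X ^ 2 *
          cT1 (Polynomial.C P) Polynomial.X ^ 3) := by
    unfold cE4; simp only [map_mul, map_neg, map_ofNat, map_pow, map_sub, map_one]
  rw [this]
  exact pcoef_le _ (pmul_le (ppow_le 2 (dS hc).le le_rfl) (ppow_le 3 dT1.le le_rfl) le_rfl)

variable {F G : MvPolynomial (Fin 4) ℂ} {d m : ℕ}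

lemma eval_H (t : ℂ) : (aeval (pE P k c) G).eval t =
    eval ![cE1 P k t, cE2 P k c t, cE3 P k c t, cE4 P k c t] G := by
  rw [eval_aeval]
  congr 2
  funext i
  exact eval_pE t i

lemma H_natDegree (g : GoodPar P k c) (hF : F.IsHomogeneous d)
    (hG : ∀ x e1 e2 e3 e4, IsES x e1 e2 e3 e4 → NF F x = eval ![e1, e2, e3, e4] G) :
    (aeval (pE P k c) G).natDegree ≤ 9 * (192 * d) := by
  obtain ⟨K1, -, h1⟩ := poly_growth (pE P k c 0) (n := 9) dE1
  obtain ⟨K2, -, h2⟩ := poly_growth (pE P k c 1) (n := 18) (dE2 g.hc)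
  obtain ⟨K3, -, h3⟩ := poly_growth (pE P k c 2) (n := 27) (dE3 g.hc)
  obtain ⟨K4, -, h4⟩ := poly_growth (pE P k c 3) (n := 36) (dE4 g.hc)
  obtain ⟨K, hK, k1, k2, k3, k4⟩ := exK K1 K2 K3 K4
  obtain ⟨C, -, hC⟩ := G_inf hF hG K hK
  refine natDegree_le_of_growth _ _ C fun t ht => ?_
  rw [eval_H, pow_mul]
  have e1 := h1 t ht
  have e2 := h2 t ht
  have e3 := h3 t ht
  have e4 := h4 t ht
  rw [eval_pE] at e1 e2 e3 e4
  refine hC _ _ _ _ (‖t‖ ^ 9) (by positivity) ?_ ?_ ?_ ?_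
  · exact e1.trans (by gcongr)
  · rw [← pow_mul]; exact e2.trans (by gcongr)
  · rw [← pow_mul]; exact e3.trans (by gcongr)
  · rw [← pow_mul]; exact e4.trans (by gcongr)

lemma H_dvd (g : GoodPar P k c) (hF : F.IsHomogeneous d)
    (hv : ∀ v ∈ F4Config, vanishesToOrder F v m)
    (hG : ∀ x e1 e2 e3 e4, IsES x e1 e2 e3 e4 → NF F x = eval ![e1, e2, e3, e4] G) :
    pB P k c ^ (192 * m) ∣ aeval (pE P k c) G := by
  have hB : pB P k c ≠ 0 := by
    intro h; have := dB (P := P) (k := k) g.hc; rw [h] at this; simp at this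
  refine dvd_of_bound (pow_ne_zero _ hB) fun t0 h0 => ?_
  rw [Polynomial.eval_pow] at h0
  replace h0 := eq_zero_of_pow_eq_zero h0
  rw [eval_pB] at h0
  simp only [eval_H, Polynomial.eval_pow, eval_pB, norm_pow]
  rcases mul_eq_zero.mp h0 with h | h
  · rcases mul_eq_zero.mp h with h | h
    · simpa only [norm_pow] using local_S g hF hv hG h
    · simpa only [norm_pow] using local_T1 g hF hv hG h
  · simpa only [norm_pow] using local_T2 g hF hv hG (pow_eq_zero_iff two_ne_zero |>.mp h)

lemma curve_zero (g : GoodPar P k c) (hF : F.IsHomogeneous d)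
    (hv : ∀ v ∈ F4Config, vanishesToOrder F v m)
    (hG : ∀ x e1 e2 e3 e4, IsES x e1 e2 e3 e4 → NF F x = eval ![e1, e2, e3, e4] G)
    (hlt : 3 * d < 8 * m) (t : ℂ) :
    eval ![cE1 P k t, cE2 P k c t, cE3 P k c t, cE4 P k c t] G = 0 := by
  rw [← eval_H, Polynomial.eq_zero_of_dvd_of_natDegree_lt (H_dvd g hF hv hG),
    Polynomial.eval_zero]
  refine lt_of_le_of_lt (H_natDegree g hF hG) ?_
  rw [Polynomial.natDegree_pow, dB g.hc]
  omega
end Global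


section Cover

/-- vanishing on the whole family of curves -/
def CurveVan (M : MvPolynomial (Fin 4) ℂ) : Prop :=
  ∀ P k c : ℂ, GoodPar P k c → ∀ t : ℂ,
    eval ![cE1 P k t, cA P k c t, cZ P k c t, cE4 P k c t] M = 0

lemma eval_bind4 (M a b c d : MvPolynomial (Fin 4) ℂ) (x : Fin 4 → ℂ) :
    eval x (aeval ![a, b, c, d] M) = eval ![eval x a, eval x b, eval x c, eval x d] M := by
  induction M using MvPolynomial.induction_on with
  | C a => simp
  | add p q hp hq => rw [map_add, map_add, map_add, hp, hq]
  | mul_X p i hp =>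
    rw [map_mul, map_mul, map_mul, hp, aeval_X, eval_X]
    congr 1
    fin_cases i <;> rfl

lemma cover_gen {M : MvPolynomial (Fin 4) ℂ} (hM : CurveVan M) (e A u : ℂ)
    (he : e ≠ 0) (hA : A ≠ 0) (hu : u ≠ 0) (hu1 : u - 1 ≠ 0) (hu2 : 2 * u - 1 ≠ 0)
    (h1 : 16 * A * u - e ^ 2 ≠ 0) (h2 : 16 * A * (u - 1) + e ^ 2 ≠ 0) :
    eval ![e, A, 0, A ^ 2 * u * (1 - u)] M = 0 := by
  set P : ℂ := (2 * u - 1) / u with hP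
  have hPu : P * u = 2 * u - 1 := by rw [hP]; field_simp
  have hP0 : P ≠ 0 := div_ne_zero hu2 hu
  set k : ℂ := -e / (12 * P ^ 3) with hk
  have hke : e = -12 * P ^ 3 * k := by rw [hk]; field_simp
  have hk0 : k ≠ 0 := div_ne_zero (neg_ne_zero.mpr he) (by simpa using hP0)
  set c : ℂ := (A * u / (9 * P ^ 6) - k ^ 2) / P with hc
  have hcA : 9 * P ^ 6 * (c * P + k ^ 2) = A * u := by rw [hc]; field_simp; ring
  have hg : GoodPar P k c := by
    refine ⟨hP0, ?_, hk0, ?_, ?_, ?_⟩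
    · intro h
      exact hu1 (by linear_combination u * h - hPu)
    · intro h
      rw [h] at hcA
      apply h1
      rw [hke]
      linear_combination -16 * hcA
    · intro h
      rw [h] at hcA
      exact mul_ne_zero hA hu (by linear_combination -hcA)
    · intro h
      apply h2
      rw [hke]
      have h3 : u * P * 9 * P ^ 6 * (c * (P - 1) + k ^ 2) = 0 := by rw [h]; ring
      have h4 : u * (16 * A * (u - 1) + (-12 * P ^ 3 * k) ^ 2) = 0 := by
        linear_combination 16 * h3 - 16 * (u * P - u) * hcA
          - 16 * A * u * hPu
      exact (mul_eq_zero.mp h4).resolve_left hu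
  have h := hM P k c hg 0
  have hw : (2 - P) * u = 1 := by linear_combination -hPu
  have hS : 3 * cS P k c 0 = A * u / P ^ 2 := by
    rw [eq_div_iff (pow_ne_zero _ hP0), ← hcA]
    simp [cS, cT1, cT2, cD, cEta]; ring
  have v1 : cE1 P k 0 = e := by
    rw [hke]; simp [cE1, cL, cN, cD, cDel]; ring
  have v2 : cA P k c 0 = A := by
    have : cA P k c 0 = 3 * cS P k c 0 * (P ^ 2 * (2 - P)) := by
      simp [cA, cW]; ring
    rw [this, hS]
    field_simp
    linear_combination hw
  have v3 : cZ P k c 0 = 0 := by simp [cZ]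
  have v4 : cE4 P k c 0 = A ^ 2 * u * (1 - u) := by
    have : cE4 P k c 0 = (3 * cS P k c 0) ^ 2 * (P ^ 4 * (1 - P)) := by
      simp [cE4, cT1]; ring
    rw [this, hS]
    field_simp
    linear_combination - hPu
  rwa [v1, v2, v3, v4] at h

lemma cover_u {M : MvPolynomial (Fin 4) ℂ} (hM : CurveVan M) (e A u : ℂ) :
    eval ![e, A, 0, A ^ 2 * u * (1 - u)] M = 0 := by
  set N : MvPolynomial (Fin 4) ℂ := aeval ![X 0, X 1, 0, X 1 ^ 2 * X 3 * (1 - X 3)] M with hN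
  set B : MvPolynomial (Fin 4) ℂ := X 0 * X 1 * X 3 * (X 3 - 1) * (2 * X 3 - 1) *
    (16 * X 1 * X 3 - X 0 ^ 2) * (16 * X 1 * (X 3 - 1) + X 0 ^ 2) with hB
  have hev : ∀ x, eval x N = eval ![x 0, x 1, 0, x 1 ^ 2 * x 3 * (1 - x 3)] M := by
    intro x; rw [hN, eval_bind4]; simp
  have hBx : ∀ x, eval x B = x 0 * x 1 * x 3 * (x 3 - 1) * (2 * x 3 - 1) *
    (16 * x 1 * x 3 - x 0 ^ 2) * (16 * x 1 * (x 3 - 1) + x 0 ^ 2) := by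
    intro x; rw [hB]; simp
  have h0 : N * B = 0 := by
    refine MvPolynomial.funext fun x => ?_
    rw [map_mul, map_zero]
    by_cases hb : eval x B = 0
    · rw [hb, mul_zero]
    · rw [hBx] at hb
      simp only [mul_ne_zero_iff] at hb
      obtain ⟨⟨⟨⟨⟨⟨b1, b2⟩, b3⟩, b4⟩, b5⟩, b6⟩, b7⟩ := hb
      rw [hev, cover_gen hM _ _ _ b1 b2 b3 b4 b5 (by simpa [mul_assoc] using b6)
        (by simpa [mul_assoc] using b7), zero_mul]
  have hB0 : B ≠ 0 := by
    intro h
    have := hBx ![1, 1, 0, 3]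
    rw [h] at this
    rw [show (![1, 1, 0, 3] : Fin 4 → ℂ) 3 = 3 from rfl] at this
    norm_num at this
  have hN0 : N = 0 := (mul_eq_zero.mp h0).resolve_right hB0
  have := hev ![e, A, 0, u]
  rw [hN0] at this
  simpa using this.symm

lemma cover_z {M : MvPolynomial (Fin 4) ℂ} (hM : CurveVan M) :
    aeval ![X 0, X 1, 0, X 3] M = (0 : MvPolynomial (Fin 4) ℂ) := by
  have h0 : X 1 * aeval ![X 0, X 1, 0, X 3] M = (0 : MvPolynomial (Fin 4) ℂ) := by
    refine MvPolynomial.funext fun x => ?_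
    rw [map_mul, map_zero, eval_bind4]
    simp only [eval_X, map_zero]
    by_cases hA : x 1 = 0
    · rw [hA, zero_mul]
    · obtain ⟨s, hs⟩ := IsAlgClosed.exists_pow_nat_eq (1 - 4 * x 3 / x 1 ^ 2) (n := 2) (by norm_num)
      have := cover_u hM (x 0) (x 1) ((1 + s) / 2)
      rw [show x 1 ^ 2 * ((1 + s) / 2) * (1 - (1 + s) / 2) = x 3 by
        have : x 1 ^ 2 * ((1 + s) / 2) * (1 - (1 + s) / 2) = x 1 ^ 2 * (1 - s ^ 2) / 4 := by ring
        rw [this, hs]; field_simp; ring] at this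
      rw [this, mul_zero]
  exact (mul_eq_zero.mp h0).resolve_left (X_ne_zero 1)

lemma dvd_sub_z (M : MvPolynomial (Fin 4) ℂ) : X 2 ∣ M - aeval ![X 0, X 1, 0, X 3] M := by
  induction M using MvPolynomial.induction_on with
  | C a => simp
  | add p q hp hq =>
    rw [map_add, add_sub_add_comm]; exact dvd_add hp hq
  | mul_X p i hp =>
    rw [map_mul, aeval_X]
    have : p * X i - aeval ![X 0, X 1, 0, X 3] p * (![X 0, X 1, 0, X 3] : Fin 4 → MvPolynomial (Fin 4) ℂ) i
      = (p - aeval ![X 0, X 1, 0, X 3] p) * X i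
        + aeval ![X 0, X 1, 0, X 3] p * (X i - (![X 0, X 1, 0, X 3] : Fin 4 → MvPolynomial (Fin 4) ℂ) i) := by
      ring
    rw [this]
    refine dvd_add (dvd_mul_of_dvd_left hp _) (dvd_mul_of_dvd_right ?_ _)
    fin_cases i <;> simp

lemma curveVan_quot {Q : MvPolynomial (Fin 4) ℂ} (h : CurveVan (X 2 * Q)) : CurveVan Q := by
  intro P k c g t
  set z : Polynomial ℂ := cZ (Polynomial.C P) (Polynomial.C k) (Polynomial.C c) Polynomial.X
  set f : Fin 4 → Polynomial ℂ := ![cE1 (Polynomial.C P) (Polynomial.C k) Polynomial.X,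
    cA (Polynomial.C P) (Polynomial.C k) (Polynomial.C c) Polynomial.X, z,
    cE4 (Polynomial.C P) (Polynomial.C k) (Polynomial.C c) Polynomial.X] with hf
  have hev : ∀ s i, (f i).eval s = ![cE1 P k s, cA P k c s, cZ P k c s, cE4 P k c s] i := by
    intro s i
    fin_cases i
    · simp [hf, cE1, eval_cL]
    · simp [hf, cA, eval_cS, cW]
    · simp [hf, z, cZ, eval_cS, cT2]
    · simp [hf, cE4, eval_cS, cT1]
  have hev2 : ∀ (M : MvPolynomial (Fin 4) ℂ) s, (aeval f M).eval s =
      eval ![cE1 P k s, cA P k c s, cZ P k c s, cE4 P k c s] M := by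
    intro M s
    rw [eval_aeval]
    congr 2
    funext i
    exact hev s i
  have hz : z ≠ 0 := by
    have hS : cS (Polynomial.C P) (Polynomial.C k) (Polynomial.C c) Polynomial.X ≠ 0 := by
      intro h; have := dS (P := P) (k := k) g.hc; rw [h] at this; simp at this
    have hX1 : (Polynomial.X - 1 : Polynomial ℂ) ≠ 0 := by
      rw [← Polynomial.C_1]; exact Polynomial.X_sub_C_ne_zero 1
    have hk : Polynomial.C k ≠ 0 := by simpa using g.hk
    have h9 : (9 : Polynomial ℂ) ≠ 0 := by norm_num
    exact mul_ne_zero (mul_ne_zero h9 hk) (mul_ne_zero (mul_ne_zero hS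
      (mul_ne_zero Polynomial.X_ne_zero hX1)) (pow_ne_zero _ T2_ne))
  have h0 : z * aeval f Q = 0 := by
    refine Polynomial.funext fun s => ?_
    have h1 := h P k c g s
    rw [← hev2, map_mul, aeval_X] at h1
    simpa [hf] using h1
  rw [← hev2, (mul_eq_zero.mp h0).resolve_left hz, Polynomial.eval_zero]

lemma cover_zero (n : ℕ) : ∀ M : MvPolynomial (Fin 4) ℂ, M.totalDegree = n → CurveVan M → M = 0 := by
  induction n using Nat.strong_induction_on with
  | _ n ih =>
    intro M hn hM
    by_contra hM0
    have hd := dvd_sub_z M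
    rw [cover_z hM, sub_zero] at hd
    obtain ⟨Q, rfl⟩ := hd
    have hQ0 : Q ≠ 0 := right_ne_zero_of_mul hM0
    rw [totalDegree_mul_of_isDomain (X_ne_zero _) hQ0, totalDegree_X] at hn
    exact hQ0 (ih Q.totalDegree (by omega) Q rfl (curveVan_quot hM))

lemma G_zero {F G : MvPolynomial (Fin 4) ℂ} {d m : ℕ} (hF : F.IsHomogeneous d)
    (hv : ∀ v ∈ F4Config, vanishesToOrder F v m)
    (hG : ∀ x e1 e2 e3 e4, IsES x e1 e2 e3 e4 → NF F x = eval ![e1, e2, e3, e4] G)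
    (hlt : 3 * d < 8 * m) : G = 0 := by
  set M : MvPolynomial (Fin 4) ℂ :=
    aeval ![X 0, C (1 / 4) * X 0 ^ 2 + X 1, C (1 / 2) * X 0 * X 1 - X 2, X 3] G with hMdef
  have hM : M = 0 := by
    refine cover_zero _ M rfl fun P k c g t => ?_
    rw [hMdef, eval_bind4, ← curve_zero g hF hv hG hlt t]
    congr 2
    rw [cE3_eq]
    funext i
    fin_cases i
    · simp
    · simp [cE1, cE2]; ring
    · simp [cE1]
    · simp
  refine MvPolynomial.funext fun x => ?_
  rw [map_zero]
  have h : eval ![x 0, x 1 - 1 / 4 * x 0 ^ 2, 1 / 2 * x 0 * (x 1 - 1 / 4 * x 0 ^ 2) - x 2, x 3] M = 0 := by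
    rw [hM, map_zero]
  rw [hMdef, eval_bind4] at h
  rw [← h]
  congr 2
  funext i
  fin_cases i <;> simp

theorem lower_bound {F : MvPolynomial (Fin 4) ℂ} {d m : ℕ} (h0 : F ≠ 0) (hF : F.IsHomogeneous d)
    (hv : ∀ v ∈ F4Config, vanishesToOrder F v m) : 8 * m ≤ 3 * d := by
  by_contra hlt
  push Not at hlt
  obtain ⟨G, hG⟩ := exists_sym' F
  exact h0 (sym_zero hG (G_zero hF hv hG hlt))
end Cover


section Upper

lemma foldl_add (l : List (Fin 4)) : ∀ F G : MvPolynomial (Fin 4) ℂ,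
    l.foldl (fun G i => pderiv i G) (F + G) =
      l.foldl (fun G i => pderiv i G) F + l.foldl (fun G i => pderiv i G) G := by
  induction l with
  | nil => intro F G; rfl
  | cons i l ih => intro F G; simp only [List.foldl_cons, map_add, ih]

lemma vto_pderiv {F : MvPolynomial (Fin 4) ℂ} {v : Fin 4 → ℂ} {a : ℕ} (i : Fin 4)
    (h : vanishesToOrder F v a) : vanishesToOrder (pderiv i F) v (a - 1) := by
  intro l hl
  exact h (i :: l) (by rw [List.length_cons]; omega)

lemma vto_mul_aux {v : Fin 4 → ℂ} (l : List (Fin 4)) :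
    ∀ (F G : MvPolynomial (Fin 4) ℂ) (a b : ℕ), vanishesToOrder F v a → vanishesToOrder G v b →
      l.length < a + b → eval v (l.foldl (fun G i => pderiv i G) (F * G)) = 0 := by
  induction l with
  | nil =>
    intro F G a b hF hG hl
    simp only [List.length_nil] at hl
    rw [List.foldl_nil, map_mul]
    rcases Nat.eq_zero_or_pos a with ha | ha
    · have : eval v G = 0 := hG [] (by simp; omega)
      rw [this, mul_zero]
    · have : eval v F = 0 := hF [] (by simpa using ha)
      rw [this, zero_mul]
  | cons i l ih =>
    intro F G a b hF hG hl
    rw [List.length_cons] at hl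
    rw [List.foldl_cons, Derivation.leibniz, smul_eq_mul, smul_eq_mul, foldl_add, map_add,
      ih F (pderiv i G) a (b - 1) hF (vto_pderiv i hG) (by omega),
      ih G (pderiv i F) b (a - 1) hG (vto_pderiv i hF) (by omega), add_zero]

lemma vto_mul {v : Fin 4 → ℂ} {F G : MvPolynomial (Fin 4) ℂ} {a b : ℕ}
    (hF : vanishesToOrder F v a) (hG : vanishesToOrder G v b) :
    vanishesToOrder (F * G) v (a + b) :=
  fun l hl => vto_mul_aux l F G a b hF hG hl

lemma vto_zero {v : Fin 4 → ℂ} {F : MvPolynomial (Fin 4) ℂ} : vanishesToOrder F v 0 :=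
  fun l hl => absurd hl (Nat.not_lt_zero _)

lemma vto_mono {v : Fin 4 → ℂ} {F : MvPolynomial (Fin 4) ℂ} {a b : ℕ} (hab : a ≤ b)
    (h : vanishesToOrder F v b) : vanishesToOrder F v a :=
  fun l hl => h l (hl.trans_le hab)

lemma vto_prod {v : Fin 4 → ℂ} (f : Fin 24 → MvPolynomial (Fin 4) ℂ) (a : Fin 24 → ℕ)
    (h : ∀ j, vanishesToOrder (f j) v (a j)) (s : Finset (Fin 24)) :
    vanishesToOrder (∏ j ∈ s, f j) v (∑ j ∈ s, a j) := by
  classical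
  induction s using Finset.induction_on with
  | empty => exact vto_zero
  | insert j s hj ih => rw [Finset.prod_insert hj, Finset.sum_insert hj]; exact vto_mul (h j) ih

lemma vto_pow {v : Fin 4 → ℂ} {F : MvPolynomial (Fin 4) ℂ} {a : ℕ}
    (h : vanishesToOrder F v a) (n : ℕ) : vanishesToOrder (F ^ n) v (a * n) := by
  induction n with
  | zero => exact vto_zero
  | succ n ih => rw [pow_succ, Nat.mul_succ]; exact vto_mul ih h

/-- the linear form dual to a point of the configuration -/
noncomputable def linF (j : Fin 24) : MvPolynomial (Fin 4) ℂ :=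
  ∑ i, C ((F4Z j i : ℤ) : ℂ) * X i

lemma linF_homog (j : Fin 24) : (linF j).IsHomogeneous 1 := by
  unfold linF
  refine IsHomogeneous.sum _ _ _ fun i _ => ?_
  simpa using (isHomogeneous_C (Fin 4) ((F4Z j i : ℤ) : ℂ)).mul (isHomogeneous_X ℂ i)

lemma linF_eval (j k : Fin 24) : eval (F4Pts k) (linF j) = ((∑ i, F4Z j i * F4Z k i : ℤ) : ℂ) := by
  unfold linF
  simp [F4Pts_eq]

lemma self_dot : ∀ j : Fin 24, (∑ i, F4Z j i * F4Z j i : ℤ) ≠ 0 := by decide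

lemma nine_planes : ∀ k : Fin 24,
    ∑ j : Fin 24, (if (∑ i, F4Z j i * F4Z k i : ℤ) = 0 then 1 else 0 : ℕ) = 9 := by decide

lemma linF_ne (j : Fin 24) : linF j ≠ 0 := by
  intro h
  have := linF_eval j j
  rw [h, map_zero] at this
  exact self_dot j (by exact_mod_cast this.symm)

/-- the product of the linear forms of the arrangement -/
noncomputable def arrF : MvPolynomial (Fin 4) ℂ := ∏ j, linF j

lemma arrF_ne : arrF ≠ 0 := Finset.prod_ne_zero_iff.mpr fun j _ => linF_ne j

lemma arrF_homog : arrF.IsHomogeneous 24 := by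
  have := IsHomogeneous.prod Finset.univ linF (fun _ => 1) fun j _ => linF_homog j
  unfold arrF
  simpa using this

lemma arrF_vto : ∀ v ∈ F4Config, vanishesToOrder arrF v 9 := by
  rintro v ⟨k, rfl⟩
  rw [← nine_planes k]
  refine vto_prod linF _ (fun j => ?_) Finset.univ
  split_ifs with h
  · intro l hl
    have : l = [] := List.length_eq_zero_iff.mp (by omega)
    subst this
    rw [List.foldl_nil, linF_eval, h, Int.cast_zero]
  · exact vto_zero

lemma alpha_mem (m : ℕ) : ∃ F : MvPolynomial (Fin 4) ℂ, F ≠ 0 ∧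
    F.IsHomogeneous (alphaSymbolic F4Config m) ∧ ∀ v ∈ F4Config, vanishesToOrder F v m := by
  have hne : { d | ∃ F : MvPolynomial (Fin 4) ℂ, F ≠ 0 ∧ F.IsHomogeneous d ∧
    ∀ v ∈ F4Config, vanishesToOrder F v m }.Nonempty :=
    ⟨24 * m, arrF ^ m, pow_ne_zero _ arrF_ne, arrF_homog.pow m,
      fun v hv => vto_mono (by omega) (vto_pow (arrF_vto v hv) m)⟩
  exact Nat.sInf_mem hne

lemma alpha_lower (m : ℕ) : 8 * m ≤ 3 * alphaSymbolic F4Config m := by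
  obtain ⟨F, h0, hF, hv⟩ := alpha_mem m
  exact lower_bound h0 hF hv

lemma alpha_nine : alphaSymbolic F4Config 9 = 24 := by
  refine le_antisymm (Nat.sInf_le ⟨arrF, arrF_ne, arrF_homog, arrF_vto⟩) ?_
  have := alpha_lower 9
  omega
end Upper

/-- The Waldschmidt constant of the F4 configuration equals 8/3. -/
theorem waldschmidt_F4 :
    sInf { x : ℝ | ∃ m : ℕ, 1 ≤ m ∧ x = (alphaSymbolic F4Config m : ℝ) / m } = 8 / 3 := by
  refine IsLeast.csInf_eq ⟨⟨9, by norm_num, ?_⟩, ?_⟩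
  · rw [alpha_nine]; norm_num
  · rintro x ⟨m, hm, rfl⟩
    have hm0 : (0 : ℝ) < m := by exact_mod_cast hm
    rw [div_le_div_iff₀ (by norm_num) hm0]
    have : (8 : ℝ) * m ≤ 3 * alphaSymbolic F4Config m := by exact_mod_cast alpha_lower m
    linarith
end

section
/- For every odd positive integer p, every nonzero homogeneous polynomial in ℂ[x,y,z,w] vanishing to order at least 18p at each of the 24 points of the F4 configuration has degree at least 48p; that is, α(I(F4)^{(18p)}) ≥ 48p. -/
open MvPolynomial

/-! ### Multiplicities -/

/-- Recursive form of vanishing to order `m` at `v`. -/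
def DV {σ : Type} (v : σ → ℂ) : ℕ → MvPolynomial σ ℂ → Prop
  | 0, _ => True
  | m + 1, F => eval v F = 0 ∧ ∀ i, DV v m (pderiv i F)

theorem DV_of_vanishes (v : Fin 4 → ℂ) (m : ℕ) :
    ∀ F : MvPolynomial (Fin 4) ℂ, vanishesToOrder F v m → DV v m F := by
  induction m with
  | zero => intro F _; trivial
  | succ m ih =>
    intro F h
    refine ⟨h [] (by simp), fun i => ih _ fun l hl => ?_⟩
    exact h (i :: l) (by simpa using hl)

section general
variable {σ : Type}

theorem DV_zero (v : σ → ℂ) (m : ℕ) : DV v m (0 : MvPolynomial σ ℂ) := by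
  induction m with
  | zero => trivial
  | succ m ih => exact ⟨by simp, fun i => by simpa using ih⟩

theorem DV_add (v : σ → ℂ) (m : ℕ) : ∀ F G : MvPolynomial σ ℂ,
    DV v m F → DV v m G → DV v m (F + G) := by
  induction m with
  | zero => intros; trivial
  | succ m ih =>
    intro F G hF hG
    refine ⟨by simp [hF.1, hG.1], fun i => ?_⟩
    rw [map_add]
    exact ih _ _ (hF.2 i) (hG.2 i)

theorem DV_C_mul (v : σ → ℂ) (m : ℕ) (c : ℂ) : ∀ F : MvPolynomial σ ℂ,
    DV v m F → DV v m (C c * F) := by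
  induction m with
  | zero => intros; trivial
  | succ m ih =>
    intro F hF
    refine ⟨by simp [hF.1], fun i => ?_⟩
    rw [pderiv_C_mul]
    exact ih _ (hF.2 i)

theorem DV_sum {ι : Type} (s : Finset ι) (v : σ → ℂ) (m : ℕ) (F : ι → MvPolynomial σ ℂ)
    (h : ∀ i ∈ s, DV v m (F i)) : DV v m (∑ i ∈ s, F i) := by
  classical
  induction s using Finset.induction_on with
  | empty => simpa using DV_zero v m
  | insert a s ha ih =>
    rw [Finset.sum_insert ha]
    exact DV_add _ _ _ _ (h a (by simp)) (ih fun i hi => h i (by simp [hi]))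

theorem DV_succ (v : σ → ℂ) (m : ℕ) : ∀ F : MvPolynomial σ ℂ, DV v (m + 1) F → DV v m F := by
  induction m with
  | zero => intros; trivial
  | succ m ih => intro F h; exact ⟨h.1, fun i => ih _ (h.2 i)⟩

theorem DV_mono (v : σ → ℂ) {m n : ℕ} (h : m ≤ n) (F : MvPolynomial σ ℂ) (hF : DV v n F) :
    DV v m F := by
  induction n, h using Nat.le_induction with
  | base => exact hF
  | succ n _ ih => exact ih (DV_succ _ _ _ hF)

theorem DV_pderiv (v : σ → ℂ) (m : ℕ) (F : MvPolynomial σ ℂ) (hF : DV v m F) (i : σ) :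
    DV v (m - 1) (pderiv i F) := by
  cases m with
  | zero => trivial
  | succ m => exact hF.2 i

theorem eval_smul_hom (F : MvPolynomial σ ℂ) (d : ℕ) (hF : F.IsHomogeneous d) (c : ℂ)
    (v : σ → ℂ) : eval (c • v) F = c ^ d * eval v F := by
  rw [eval_eq, eval_eq, Finset.mul_sum]
  refine Finset.sum_congr rfl fun s hs => ?_
  have : s.degree = d := by
    by_contra h
    exact (mem_support_iff.1 hs) (hF.coeff_eq_zero h)
  simp only [Pi.smul_apply, smul_eq_mul, mul_pow, Finset.prod_mul_distrib]
  rw [Finset.prod_pow_eq_pow_sum, ← this]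
  simp only [Finsupp.degree_apply]
  ring

theorem DV_smul (v : σ → ℂ) (c : ℂ) (m : ℕ) : ∀ (F : MvPolynomial σ ℂ) (d : ℕ),
    F.IsHomogeneous d → DV v m F → DV (c • v) m F := by
  induction m with
  | zero => intros; trivial
  | succ m ih =>
    intro F d hd h
    refine ⟨by rw [eval_smul_hom F d hd, h.1, mul_zero], fun i => ih _ (d - 1) hd.pderiv (h.2 i)⟩

theorem chain_rule [Fintype σ] {A : Type} [CommRing A] [Algebra ℂ A] (D : Derivation ℂ A A)
    (g : σ → A) (F : MvPolynomial σ ℂ) :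
    D (aeval g F) = ∑ i, aeval g (pderiv i F) * D (g i) := by
  classical
  induction F using MvPolynomial.induction_on with
  | C a => simp
  | add p q hp hq => simp [hp, hq, add_mul, Finset.sum_add_distrib]
  | mul_X p j hp =>
    have h1 : ∀ i, aeval g (pderiv i (p * X j)) * D (g i)
        = (if i = j then aeval g p * D (g j) else 0)
          + g j * (aeval g (pderiv i p) * D (g i)) := by
      intro i
      rw [pderiv_mul, pderiv_X]
      by_cases h : i = j
      · subst h
        simp
        ring
      · simp [h]
        ring
    rw [Finset.sum_congr rfl fun i _ => h1 i, Finset.sum_add_distrib, ← Finset.mul_sum, ← hp,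
      map_mul, aeval_X, Derivation.leibniz]
    simp

theorem eval_aeval_s8 {τ : Type} (g : σ → MvPolynomial τ ℂ) (F : MvPolynomial σ ℂ) (x : τ → ℂ) :
    eval x (aeval g F) = eval (fun i => eval x (g i)) F := by
  induction F using MvPolynomial.induction_on with
  | C a => simp
  | add p q hp hq => rw [map_add, map_add, map_add, hp, hq]
  | mul_X p j hp => rw [map_mul, map_mul, map_mul, hp, aeval_X, eval_X]

theorem pderiv_swap (i j : σ) (F : MvPolynomial σ ℂ) :
    pderiv i (pderiv j F) = pderiv j (pderiv i F) := by
  classical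
  induction F using MvPolynomial.induction_on with
  | C a => simp
  | add p q hp hq => simp [hp, hq]
  | mul_X p k hp =>
    simp only [pderiv_mul, map_add, hp, pderiv_X]
    have h : ∀ a b : σ, pderiv a ((Pi.single b 1 : σ → MvPolynomial σ ℂ) k) = 0 := by
      intro a b
      by_cases hb : k = b
      · subst hb; simp
      · simp [Pi.single_eq_of_ne hb]
    rw [h, h]
    ring

/-- Linear substitutions. -/
theorem DV_comp {τ : Type} [Fintype σ] (g : σ → MvPolynomial τ ℂ) (a : σ → τ → ℂ)
    (hg : ∀ i j, pderiv j (g i) = C (a i j)) (v : τ → ℂ) (m : ℕ) :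
    ∀ F : MvPolynomial σ ℂ, DV (fun i => eval v (g i)) m F → DV v m (aeval g F) := by
  induction m with
  | zero => intros; trivial
  | succ m ih =>
    intro F h
    refine ⟨?_, fun j => ?_⟩
    · have := h.1
      rw [← this, eval_aeval_s8]
    · rw [chain_rule]
      refine DV_sum _ _ _ _ fun i _ => ?_
      rw [hg, mul_comm]
      exact DV_C_mul _ _ _ _ (ih _ (h.2 i))

/-! ### Removing linear factors -/

/-- The linear form with coefficients `a`. -/
noncomputable def lin [Fintype σ] (a : σ → ℂ) : MvPolynomial σ ℂ := ∑ i, C (a i) * X i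

theorem lin_eval [Fintype σ] (a v : σ → ℂ) : eval v (lin a) = ∑ i, a i * v i := by
  simp [lin]

theorem lin_pderiv [Fintype σ] (a : σ → ℂ) (i : σ) : pderiv i (lin a) = C (a i) := by
  classical
  simp only [lin, map_sum, pderiv_C_mul, pderiv_X]
  rw [Finset.sum_eq_single i]
  · simp
  · intro b _ hb
    simp [Pi.single_eq_of_ne hb]
  · simp

theorem lin_hom [Fintype σ] (a : σ → ℂ) : (lin a).IsHomogeneous 1 :=
  IsHomogeneous.sum _ _ _ fun _ _ => isHomogeneous_C_mul_X _ _

theorem DV_lin_ne [Fintype σ] (a v : σ → ℂ) (h : eval v (lin a) ≠ 0) (m : ℕ) :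
    ∀ G : MvPolynomial σ ℂ, DV v m (lin a * G) → DV v m G := by
  induction m with
  | zero => intros; trivial
  | succ m ih =>
    intro G hG
    have h1 := hG.1
    rw [map_mul] at h1
    refine ⟨(mul_eq_zero.1 h1).resolve_left h, fun i => ih _ ?_⟩
    have h2 := hG.2 i
    have h3 : DV v m G := ih _ (DV_succ _ _ _ hG)
    have h4 := DV_add _ _ _ _ h2 (DV_C_mul _ _ (-a i) _ h3)
    rw [pderiv_mul, lin_pderiv] at h4
    convert h4 using 1
    rw [C_neg]; ring

theorem DV_aux [Fintype σ] (a v : σ → ℂ) (h : eval v (lin a) = 0) (j : σ) (hj : a j ≠ 0) (m : ℕ) :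
    ∀ (G : MvPolynomial σ ℂ) (c : ℕ),
      DV v m (C ((c + 1 : ℂ) * a j) * G + lin a * pderiv j G) → DV v m G := by
  induction m with
  | zero => intros; trivial
  | succ m ih =>
    intro G c hG
    have h1 := hG.1
    rw [map_add, map_mul (eval v), map_mul (eval v), h, eval_C, zero_mul, add_zero] at h1
    have hc : (c + 1 : ℂ) ≠ 0 := by exact_mod_cast Nat.succ_ne_zero c
    have hd : DV v m (pderiv j G) := by
      apply ih _ (c + 1)
      have := hG.2 j
      convert this using 1
      simp only [map_add, pderiv_mul, pderiv_C, lin_pderiv]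
      push_cast
      simp only [C_add, C_mul, C_1]
      ring
    refine ⟨(mul_eq_zero.1 h1).resolve_left (mul_ne_zero hc hj), fun i => ih _ c ?_⟩
    have h4 := DV_add _ _ _ _ (hG.2 i) (DV_C_mul _ _ (-a i) _ hd)
    convert h4 using 1
    have hcomm : pderiv i (pderiv j G) = pderiv j (pderiv i G) := pderiv_swap i j G
    simp only [map_add, pderiv_mul, pderiv_C, lin_pderiv, C_neg, hcomm]
    ring

theorem DV_lin [Fintype σ] (a v : σ → ℂ) (h : eval v (lin a) = 0) (j : σ) (hj : a j ≠ 0) (m : ℕ)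
    (G : MvPolynomial σ ℂ) (hG : DV v m (lin a * G)) : DV v (m - 1) G := by
  cases m with
  | zero => trivial
  | succ m =>
    apply DV_aux a v h j hj m G 0
    have := hG.2 j
    rw [pderiv_mul, lin_pderiv] at this
    simpa using this

theorem lin_dvd [Fintype σ] (a : σ → ℂ) (j : σ) (hj : a j ≠ 0) (G : MvPolynomial σ ℂ)
    (h : ∀ x, eval x (lin a) = 0 → eval x G = 0) : lin a ∣ G := by
  classical
  let g : σ → MvPolynomial σ ℂ := fun i => X i - C ((Pi.single j (a j)⁻¹ : σ → ℂ) i) * lin a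
  have h0 : aeval g G = 0 := by
    apply MvPolynomial.funext
    intro x
    rw [eval_aeval_s8, map_zero]
    apply h
    rw [lin_eval]
    simp only [g, map_sub, eval_X, map_mul, eval_C, mul_sub, Finset.sum_sub_distrib]
    rw [lin_eval, Finset.sum_eq_single j (f := fun i => a i * (_ * _))]
    · rw [Pi.single_eq_same]
      field_simp
      simp
    · intro b _ hb
      simp [Pi.single_eq_of_ne hb]
    · simp
  rw [← Ideal.mem_span_singleton, ← Ideal.Quotient.eq_zero_iff_mem]
  set q := Ideal.Quotient.mkₐ ℂ (Ideal.span {lin a})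
  change q G = 0
  have : q = q.comp (aeval g) := by
    apply MvPolynomial.algHom_ext
    intro i
    have hq : q (lin a) = 0 := Ideal.Quotient.eq_zero_iff_mem.2 (Ideal.mem_span_singleton_self _)
    simp [g, hq]
  rw [this, AlgHom.comp_apply, h0, map_zero]

theorem hom_of_mul (ℓ G : MvPolynomial σ ℂ) (hℓ : ℓ.IsHomogeneous 1) (h0 : ℓ ≠ 0) (d : ℕ)
    (h : (ℓ * G).IsHomogeneous (1 + d)) : G.IsHomogeneous d := by
  let _ : GradedAlgebra (homogeneousSubmodule σ ℂ) := MvPolynomial.gradedAlgebra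
  have key := DirectSum.coe_decompose_mul_add_of_left_mem (homogeneousSubmodule σ ℂ)
    (a := ℓ) (b := G) (i := 1) (j := d) hℓ
  rw [DirectSum.decompose_of_mem_same _ h] at key
  rw [mul_left_cancel₀ h0 key]
  exact (DirectSum.decompose (homogeneousSubmodule σ ℂ) G d).2

end general

/-! ### Restriction to lines -/

section lines
variable {σ : Type} [Fintype σ]

/-- Restriction of `F` to the parametrized line `u + t w`. -/
noncomputable def res (u w : σ → ℂ) (F : MvPolynomial σ ℂ) : Polynomial ℂ :=
  aeval (fun i => Polynomial.C (u i) + Polynomial.X * Polynomial.C (w i)) F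

theorem res_eval (u w : σ → ℂ) (F : MvPolynomial σ ℂ) (t : ℂ) :
    (res u w F).eval t = eval (u + t • w) F := by
  unfold res
  induction F using MvPolynomial.induction_on with
  | C a => simp
  | add p q hp hq => rw [map_add, map_add, Polynomial.eval_add, hp, hq]
  | mul_X p j hp => rw [map_mul, map_mul, Polynomial.eval_mul, hp, aeval_X, eval_X]; simp; left; ring

theorem res_derivative (u w : σ → ℂ) (F : MvPolynomial σ ℂ) :
    Polynomial.derivative (res u w F) = ∑ i, res u w (pderiv i F) * Polynomial.C (w i) := by
  have := chain_rule (Polynomial.derivative' (R := ℂ))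
    (fun i => Polynomial.C (u i) + Polynomial.X * Polynomial.C (w i)) F
  simpa [res] using this

theorem res_natDegree (u w : σ → ℂ) (F : MvPolynomial σ ℂ) (d : ℕ) (hF : F.IsHomogeneous d) :
    (res u w F).natDegree ≤ d := by
  unfold res
  rw [aeval_def, eval₂_eq']
  refine Polynomial.natDegree_sum_le_of_forall_le _ _ fun s hs => ?_
  have hsd : ∑ i, s i = d := by
    by_contra h
    refine (mem_support_iff.1 hs) (hF.coeff_eq_zero ?_)
    rwa [Finsupp.degree_eq_sum]
  refine (Polynomial.natDegree_C_mul_le _ _).trans ?_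
  refine (Polynomial.natDegree_prod_le _ _).trans ?_
  rw [← hsd]
  refine Finset.sum_le_sum fun i _ => ?_
  refine Polynomial.natDegree_pow_le.trans ?_
  have : (Polynomial.C (u i) + Polynomial.X * Polynomial.C (w i)).natDegree ≤ 1 := by
    compute_degree
  nlinarith

theorem DV_res (u w : σ → ℂ) (t : ℂ) (m : ℕ) : ∀ F : MvPolynomial σ ℂ,
    DV (u + t • w) m F → (Polynomial.X - Polynomial.C t) ^ m ∣ res u w F := by
  induction m with
  | zero => intros; simp
  | succ m ih =>
    intro F h
    by_cases h0 : res u w F = 0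
    · rw [h0]; exact dvd_zero _
    have hroot : (res u w F).IsRoot t := by
      rw [Polynomial.IsRoot, res_eval]; exact h.1
    have hd : (Polynomial.X - Polynomial.C t) ^ m ∣ Polynomial.derivative (res u w F) := by
      rw [res_derivative]
      exact Finset.dvd_sum fun i _ => (ih _ (h.2 i)).mul_right _
    have hpos := (Polynomial.rootMultiplicity_pos h0).2 hroot
    rw [← Polynomial.le_rootMultiplicity_iff h0]
    have hne : Polynomial.derivative (res u w F) ≠ 0 := by
      intro hz
      have := Polynomial.derivative_eq_zero.1 hz
      rw [Polynomial.eq_C_of_natDegree_eq_zero this] at hroot h0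
      simp at hroot
      simp [hroot] at h0
    rw [← Polynomial.le_rootMultiplicity_iff hne,
      Polynomial.derivative_rootMultiplicity_of_root hroot] at hd
    omega

/-- Four points `u, w, u + w, u - w` on a line. -/
theorem harm (F : MvPolynomial σ ℂ) (d : ℕ) (hF : F.IsHomogeneous d) (u w : σ → ℂ)
    (m₁ m₂ m₃ m₄ : ℕ) (h₁ : DV u m₁ F) (h₂ : DV w m₂ F) (h₃ : DV (u + w) m₃ F)
    (h₄ : DV (u - w) m₄ F) (hd : d < m₁ + m₂ + m₃ + m₄) (s t : ℂ) :
    eval (s • u + t • w) F = 0 := by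
  set U := u + (2 : ℂ) • w with hU
  set W := u - (2 : ℂ) • w with hW
  have k₁ := DV_res U W 1 m₁ F (by
    have := DV_smul u 2 m₁ F d hF h₁
    convert this using 1
    rw [hU, hW]; module)
  have k₂ := DV_res U W (-1) m₂ F (by
    have := DV_smul w 4 m₂ F d hF h₂
    convert this using 1
    rw [hU, hW]; module)
  have k₃ := DV_res U W (1/3) m₃ F (by
    have := DV_smul (u + w) (4/3) m₃ F d hF h₃
    convert this using 1
    rw [hU, hW]; module)
  have k₄ := DV_res U W 3 m₄ F (by
    have := DV_smul (u - w) 4 m₄ F d hF h₄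
    convert this using 1
    rw [hU, hW]; module)
  have cop : ∀ (a b : ℂ) (m n : ℕ), a ≠ b →
      IsCoprime ((Polynomial.X - Polynomial.C a) ^ m) ((Polynomial.X - Polynomial.C b) ^ n) :=
    fun a b m n h => (Polynomial.isCoprime_X_sub_C_of_isUnit_sub
      (sub_ne_zero.2 h).isUnit).pow
  have hdvd := IsCoprime.mul_dvd
    (((cop 1 3 m₁ m₄ (by norm_num)).mul_left (cop (-1) 3 m₂ m₄ (by norm_num))).mul_left
      (cop (1/3) 3 m₃ m₄ (by norm_num)))
    (IsCoprime.mul_dvd ((cop 1 (1/3) m₁ m₃ (by norm_num)).mul_left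
        (cop (-1) (1/3) m₂ m₃ (by norm_num)))
      (IsCoprime.mul_dvd (cop 1 (-1) m₁ m₂ (by norm_num)) k₁ k₂) k₃) k₄
  have hz : res U W F = 0 := by
    by_contra hne
    have h1 := Polynomial.natDegree_le_of_dvd hdvd hne
    have h2 := res_natDegree U W F d hF
    have hm : ∀ (a : ℂ) (m : ℕ), ((Polynomial.X - Polynomial.C a) ^ m).Monic :=
      fun a m => (Polynomial.monic_X_sub_C a).pow m
    rw [Polynomial.Monic.natDegree_mul (((hm _ _).mul (hm _ _)).mul (hm _ _)) (hm _ _),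
      Polynomial.Monic.natDegree_mul ((hm _ _).mul (hm _ _)) (hm _ _),
      Polynomial.Monic.natDegree_mul (hm _ _) (hm _ _)] at h1
    simp only [Polynomial.natDegree_pow, Polynomial.natDegree_X_sub_C, mul_one] at h1
    omega
  have hev : ∀ x y : ℂ, x ≠ 0 → eval (x • U + y • W) F = 0 := by
    intro x y hx
    have : x • U + y • W = x • (U + (y / x) • W) := by
      ext i
      simp only [Pi.add_apply, Pi.smul_apply, smul_eq_mul]
      field_simp
    rw [this, eval_smul_hom F d hF, ← res_eval, hz]
    simp
  have hev' : ∀ x y : ℂ, eval (x • U + y • W) F = 0 := by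
    intro x y
    have hr : res (y • W) U F = 0 := by
      apply Polynomial.eq_zero_of_infinite_isRoot
      refine Set.Infinite.mono (s := {0}ᶜ) ?_ (Set.finite_singleton (0 : ℂ)).infinite_compl
      intro z hz
      change (res (y • W) U F).eval z = 0
      rw [res_eval, add_comm]
      exact hev z y hz
    have := res_eval (y • W) U F x
    rw [hr, Polynomial.eval_zero, add_comm] at this
    exact this.symm
  have := hev' (s / 2 + t / 4) (s / 2 - t / 4)
  have e : s • u + t • w = (s / 2 + t / 4) • U + (s / 2 - t / 4) • W := by
    rw [hU, hW]; module
  rw [e]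
  exact this

/-- Multiplicity along a line through `u, u + w, u - w`, at the point `w`. -/
theorem mult_line (u w : σ → ℂ) (k : ℕ) : ∀ (F : MvPolynomial σ ℂ) (d m₁ m₃ m₄ : ℕ),
    F.IsHomogeneous d → DV u m₁ F → DV (u + w) m₃ F → DV (u - w) m₄ F →
    2 * k + d ≤ m₁ + m₃ + m₄ + 1 → DV w k F := by
  induction k with
  | zero => intros; trivial
  | succ k ih =>
    intro F d m₁ m₃ m₄ hF h₁ h₃ h₄ hk
    refine ⟨?_, fun i => ?_⟩
    · have := harm F d hF u w m₁ 0 m₃ m₄ h₁ trivial h₃ h₄ (by omega) 0 1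
      simpa using this
    · rcases Nat.eq_zero_or_pos d with hd | hd
      · subst hd
        rw [← totalDegree_zero_iff_isHomogeneous, totalDegree_eq_zero_iff_eq_C] at hF
        rw [hF, pderiv_C]
        exact DV_zero _ _
      · exact ih _ (d - 1) (m₁ - 1) (m₃ - 1) (m₄ - 1) hF.pderiv (DV_pderiv _ _ _ h₁ i)
          (DV_pderiv _ _ _ h₃ i) (DV_pderiv _ _ _ h₄ i) (by omega)

end lines

/-! ### Removing a linear factor, with bookkeeping -/

/-- Cast of an integer vector. -/
def cv {k : ℕ} (z : Fin k → ℤ) : Fin k → ℂ := fun i => (z i : ℂ)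

theorem remove {n k : ℕ} (pz : Fin n → Fin k → ℤ) (az : Fin k → ℤ) (j : Fin k) (hj : az j ≠ 0)
    (wt : Fin n → ℕ) (W : ℕ)
    (hw : ∑ i, (if ∑ l, az l * pz i l = 0 then wt i else 0) ≤ W)
    (F : MvPolynomial (Fin k) ℂ) (d : ℕ) (hF : F ≠ 0) (hd : F.IsHomogeneous d)
    (m : Fin n → ℕ) (hm : ∀ i, DV (cv (pz i)) (m i) F) (hdvd : lin (cv az) ∣ F) :
    ∃ (G : MvPolynomial (Fin k) ℂ) (d' : ℕ) (m' : Fin n → ℕ), d = d' + 1 ∧ G ≠ 0 ∧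
      G.IsHomogeneous d' ∧ (∀ i, DV (cv (pz i)) (m' i) G) ∧
      ∑ i, wt i * m i ≤ ∑ i, wt i * m' i + W := by
  obtain ⟨G, rfl⟩ := hdvd
  have hl0 : lin (cv az) ≠ 0 := left_ne_zero_of_mul hF
  have hG0 : G ≠ 0 := right_ne_zero_of_mul hF
  have hajC : cv az j ≠ 0 := by
    simpa [cv] using hj
  have hdpos : d ≠ 0 := by
    rintro rfl
    have h1 := hd.totalDegree hF
    rw [totalDegree_mul_of_isDomain hl0 hG0, (lin_hom (cv az)).totalDegree hl0] at h1
    omega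
  obtain ⟨d', rfl⟩ := Nat.exists_eq_succ_of_ne_zero hdpos
  have hev : ∀ i, eval (cv (pz i)) (lin (cv az)) = ((∑ l, az l * pz i l : ℤ) : ℂ) := by
    intro i
    rw [lin_eval]
    simp [cv]
  refine ⟨G, d', fun i => if ∑ l, az l * pz i l = 0 then m i - 1 else m i, rfl, hG0,
    hom_of_mul _ _ (lin_hom _) hl0 d' (by rwa [add_comm]), fun i => ?_, ?_⟩
  · dsimp only
    split_ifs with h
    · exact DV_lin _ _ (by rw [hev, h]; simp) j hajC _ _ (hm i)
    · exact DV_lin_ne _ _ (by rw [hev]; exact_mod_cast h) _ _ (hm i)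
  · refine le_trans ?_ (Nat.add_le_add_left hw _)
    rw [← Finset.sum_add_distrib]
    refine Finset.sum_le_sum fun i _ => ?_
    dsimp only
    split_ifs with h
    · have : m i ≤ (m i - 1) + 1 := by omega
      calc wt i * m i ≤ wt i * ((m i - 1) + 1) := Nat.mul_le_mul_left _ this
        _ = _ := by ring
    · simp

/-! ### The plane configuration -/

/-- Six double points, three coordinate points and four further points. -/
def Q : Fin 13 → Fin 3 → ℤ :=
  ![![1, 1, 0], ![1, -1, 0], ![1, 0, 1], ![1, 0, -1], ![0, 1, 1], ![0, 1, -1],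
    ![1, 0, 0], ![0, 1, 0], ![0, 0, 1],
    ![1, 1, 1], ![1, 1, -1], ![1, -1, 1], ![1, -1, -1]]

/-- The ten lines. -/
def QL : Fin 10 → Fin 3 → ℤ :=
  ![![1, 1, 1], ![1, 1, -1], ![1, -1, 1], ![1, -1, -1],
    ![1, -1, 0], ![1, 1, 0], ![1, 0, -1], ![1, 0, 1], ![0, 1, -1], ![0, 1, 1]]

/-- Weights of the thirteen points. -/
def Qw : Fin 13 → ℕ := ![4, 4, 4, 4, 4, 4, 2, 2, 2, 3, 3, 3, 3]

theorem QL_ne : ∀ j, ∃ i, QL j i ≠ 0 := by decide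

theorem QL_wt : ∀ j, ∑ i, (if ∑ l, QL j l * Q i l = 0 then Qw i else 0) ≤ 12 := by decide

theorem line_ineq (a u w α β ν : Fin 3 → ℤ) (hj : ∃ j, a j ≠ 0)
    (hs : ∀ i l, (if i = l then 1 else 0) = α l * u i + β l * w i + a l * ν i)
    (G : MvPolynomial (Fin 3) ℂ) (d : ℕ) (hG : G.IsHomogeneous d) (h : ¬ lin (cv a) ∣ G)
    (m₁ m₂ m₃ m₄ : ℕ) (h₁ : DV (cv u) m₁ G) (h₂ : DV (cv w) m₂ G) (h₃ : DV (cv (u + w)) m₃ G)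
    (h₄ : DV (cv (u - w)) m₄ G) : m₁ + m₂ + m₃ + m₄ ≤ d := by
  by_contra hlt
  obtain ⟨j, hj⟩ := hj
  refine h (lin_dvd (cv a) j (by simpa [cv] using hj) G fun x hx => ?_)
  rw [lin_eval] at hx
  have e : x = (∑ l, (α l : ℂ) * x l) • cv u + (∑ l, (β l : ℂ) * x l) • cv w := by
    ext i
    have h1 : x i = ∑ l, (((if i = l then 1 else 0 : ℤ)) : ℂ) * x l := by simp
    simp only [hs] at h1
    have h2 : ∑ l, cv a l * x l * (ν i : ℂ) = 0 := by rw [← Finset.sum_mul, hx, zero_mul]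
    simp only [Pi.add_apply, Pi.smul_apply, smul_eq_mul, Finset.sum_mul]
    rw [h1, ← Finset.sum_add_distrib, ← sub_eq_zero, ← Finset.sum_sub_distrib, ← h2]
    refine Finset.sum_congr rfl fun l _ => ?_
    simp only [cv]
    push_cast
    ring
  have hcu : cv (u + w) = cv u + cv w := by ext; simp [cv]
  have hcw : cv (u - w) = cv u - cv w := by ext; simp [cv]
  rw [hcu] at h₃
  rw [hcw] at h₄
  rw [e]
  exact harm G d hG _ _ m₁ m₂ m₃ m₄ h₁ h₂ h₃ h₄ (by omega) _ _

theorem plane_base (G : MvPolynomial (Fin 3) ℂ) (d : ℕ) (hG : G.IsHomogeneous d)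
    (h : ∀ j, ¬ lin (cv (QL j)) ∣ G) (m : Fin 13 → ℕ) (hm : ∀ i, DV (cv (Q i)) (m i) G) :
    ∑ i, Qw i * m i ≤ 12 * d := by
  have hc : ∀ (i : Fin 13) (c : ℤ) (z : Fin 3 → ℤ), z = c • Q i → DV (cv z) (m i) G := by
    rintro i c z rfl
    have := DV_smul _ (c : ℂ) _ G d hG (hm i)
    convert this using 1
    ext k
    simp [cv]
  have l0 := line_ineq (QL 0) ![1, -1, 0] ![0, 1, -1] ![1, 0, 0] ![1, 1, 0] ![0, 0, 1]
    (QL_ne 0) (by decide) G d hG (h 0) (m 1) (m 5) (m 3) 0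
    (hc 1 (1) _ (by decide)) (hc 5 (1) _ (by decide)) (hc 3 (1) _ (by decide)) trivial
  have l1 := line_ineq (QL 1) ![1, -1, 0] ![0, 1, 1] ![1, 0, 0] ![1, 1, 0] ![0, 0, -1]
    (QL_ne 1) (by decide) G d hG (h 1) (m 1) (m 4) (m 2) 0
    (hc 1 (1) _ (by decide)) (hc 4 (1) _ (by decide)) (hc 2 (1) _ (by decide)) trivial
  have l2 := line_ineq (QL 2) ![1, 1, 0] ![0, -1, -1] ![1, 0, 0] ![1, -1, 0] ![0, 0, 1]
    (QL_ne 2) (by decide) G d hG (h 2) (m 0) (m 4) (m 3) 0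
    (hc 0 (1) _ (by decide)) (hc 4 (-1) _ (by decide)) (hc 3 (1) _ (by decide)) trivial
  have l3 := line_ineq (QL 3) ![1, 1, 0] ![0, -1, 1] ![1, 0, 0] ![1, -1, 0] ![0, 0, -1]
    (QL_ne 3) (by decide) G d hG (h 3) (m 0) (m 5) (m 2) 0
    (hc 0 (1) _ (by decide)) (hc 5 (-1) _ (by decide)) (hc 2 (1) _ (by decide)) trivial
  have l4 := line_ineq (QL 4) ![1, 1, 0] ![0, 0, 1] ![1, 0, 0] ![0, 0, 1] ![0, -1, 0]
    (QL_ne 4) (by decide) G d hG (h 4) (m 0) (m 8) (m 9) (m 10)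
    (hc 0 (1) _ (by decide)) (hc 8 (1) _ (by decide)) (hc 9 (1) _ (by decide)) (hc 10 (1) _ (by decide))
  have l5 := line_ineq (QL 5) ![1, -1, 0] ![0, 0, 1] ![1, 0, 0] ![0, 0, 1] ![0, 1, 0]
    (QL_ne 5) (by decide) G d hG (h 5) (m 1) (m 8) (m 11) (m 12)
    (hc 1 (1) _ (by decide)) (hc 8 (1) _ (by decide)) (hc 11 (1) _ (by decide)) (hc 12 (1) _ (by decide))
  have l6 := line_ineq (QL 6) ![1, 0, 1] ![0, 1, 0] ![1, 0, 0] ![0, 1, 0] ![0, 0, -1]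
    (QL_ne 6) (by decide) G d hG (h 6) (m 2) (m 7) (m 9) (m 11)
    (hc 2 (1) _ (by decide)) (hc 7 (1) _ (by decide)) (hc 9 (1) _ (by decide)) (hc 11 (1) _ (by decide))
  have l7 := line_ineq (QL 7) ![1, 0, -1] ![0, 1, 0] ![1, 0, 0] ![0, 1, 0] ![0, 0, 1]
    (QL_ne 7) (by decide) G d hG (h 7) (m 3) (m 7) (m 10) (m 12)
    (hc 3 (1) _ (by decide)) (hc 7 (1) _ (by decide)) (hc 10 (1) _ (by decide)) (hc 12 (1) _ (by decide))
  have l8 := line_ineq (QL 8) ![0, 1, 1] ![1, 0, 0] ![0, 1, 0] ![1, 0, 0] ![0, 0, -1]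
    (QL_ne 8) (by decide) G d hG (h 8) (m 4) (m 6) (m 9) (m 12)
    (hc 4 (1) _ (by decide)) (hc 6 (1) _ (by decide)) (hc 9 (1) _ (by decide)) (hc 12 (-1) _ (by decide))
  have l9 := line_ineq (QL 9) ![0, 1, -1] ![1, 0, 0] ![0, 1, 0] ![1, 0, 0] ![0, 0, 1]
    (QL_ne 9) (by decide) G d hG (h 9) (m 5) (m 6) (m 10) (m 11)
    (hc 5 (1) _ (by decide)) (hc 6 (1) _ (by decide)) (hc 10 (1) _ (by decide)) (hc 11 (-1) _ (by decide))
  have hsum : ∑ i, Qw i * m i = 4 * m 0 + 4 * m 1 + 4 * m 2 + 4 * m 3 + 4 * m 4 + 4 * m 5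
      + 2 * m 6 + 2 * m 7 + 2 * m 8 + 3 * m 9 + 3 * m 10 + 3 * m 11 + 3 * m 12 := by
    simp only [Fin.sum_univ_succ, Fin.sum_univ_zero, Qw]
    simp [Fin.succ]
    ring
  omega

theorem plane_bound (d : ℕ) : ∀ (G : MvPolynomial (Fin 3) ℂ), G ≠ 0 → G.IsHomogeneous d →
    ∀ m : Fin 13 → ℕ, (∀ i, DV (cv (Q i)) (m i) G) → ∑ i, Qw i * m i ≤ 12 * d := by
  induction d with
  | zero =>
    intro G h0 hG m hm
    by_cases h : ∃ j, lin (cv (QL j)) ∣ G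
    · obtain ⟨j, hj⟩ := h
      obtain ⟨i, hi⟩ := QL_ne j
      obtain ⟨G', d', m', hd, _⟩ := remove Q (QL j) i hi Qw 12 (QL_wt j) G _ h0 hG m hm hj
      omega
    · exact plane_base G _ hG (not_exists.1 h) m hm
  | succ d ih =>
    intro G h0 hG m hm
    by_cases h : ∃ j, lin (cv (QL j)) ∣ G
    · obtain ⟨j, hj⟩ := h
      obtain ⟨i, hi⟩ := QL_ne j
      obtain ⟨G', d', m', hd, h0', hG', hm', hle⟩ :=
        remove Q (QL j) i hi Qw 12 (QL_wt j) G _ h0 hG m hm hj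
      obtain rfl : d = d' := by omega
      have := ih G' h0' hG' m' hm'
      omega
    · exact plane_base G _ hG (not_exists.1 h) m hm

/-- The 24 points with integer coordinates. -/
def PZ : Fin 24 → Fin 4 → ℤ :=
  ![![1, 1, 0, 0], ![1, -1, 0, 0], ![1, 0, 1, 0], ![1, 0, -1, 0],
    ![1, 0, 0, 1], ![1, 0, 0, -1], ![0, 1, 1, 0], ![0, 1, -1, 0],
    ![0, 1, 0, 1], ![0, 1, 0, -1], ![0, 0, 1, 1], ![0, 0, 1, -1],
    ![1, 0, 0, 0], ![0, 1, 0, 0], ![0, 0, 1, 0], ![0, 0, 0, 1],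
    ![1, 1, 1, 1], ![1, 1, -1, -1], ![1, -1, 1, -1], ![1, -1, -1, 1],
    ![-1, 1, 1, 1], ![1, -1, 1, 1], ![1, 1, -1, 1], ![1, 1, 1, -1]]

theorem F4Pts_eq_s8 (n : Fin 24) : F4Pts n = cv (PZ n) := by
  ext i
  fin_cases n <;> fin_cases i <;> simp [F4Pts, PZ, cv]

/-- Orthogonal frames, one for each point of the configuration. -/
def fr : Fin 24 → Fin 4 → Fin 24 :=
  ![![0, 1, 10, 11],
    ![1, 0, 10, 11],
    ![2, 3, 8, 9],
    ![3, 2, 8, 9],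
    ![4, 5, 6, 7],
    ![5, 4, 6, 7],
    ![6, 4, 5, 7],
    ![7, 4, 5, 6],
    ![8, 2, 3, 9],
    ![9, 2, 3, 8],
    ![10, 0, 1, 11],
    ![11, 0, 1, 10],
    ![12, 13, 14, 15],
    ![13, 12, 14, 15],
    ![14, 12, 13, 15],
    ![15, 12, 13, 14],
    ![16, 17, 18, 19],
    ![17, 16, 18, 19],
    ![18, 16, 17, 19],
    ![19, 16, 17, 18],
    ![20, 21, 22, 23],
    ![21, 20, 22, 23],
    ![22, 20, 21, 23],
    ![23, 20, 21, 22]]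

/-- The permutation of the points induced by the frame. -/
def sg : Fin 24 → Fin 24 → Fin 24 :=
  ![![12, 13, 16, 17, 23, 22, 21, 20, 18, 19, 14, 15, 0, 1, 10, 11, 2, 3, 8, 9, 7, 6, 5, 4],
    ![12, 13, 21, 20, 18, 19, 16, 17, 23, 22, 14, 15, 1, 0, 10, 11, 2, 3, 9, 8, 6, 7, 5, 4],
    ![12, 14, 16, 18, 23, 21, 22, 20, 17, 19, 13, 15, 2, 3, 8, 9, 0, 1, 10, 11, 7, 6, 5, 4],
    ![12, 14, 22, 20, 17, 19, 16, 18, 23, 21, 13, 15, 3, 2, 8, 9, 0, 1, 11, 10, 6, 7, 5, 4],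
    ![12, 15, 16, 19, 22, 21, 23, 20, 17, 18, 13, 14, 4, 5, 6, 7, 0, 1, 10, 11, 9, 8, 3, 2],
    ![12, 15, 23, 20, 17, 18, 16, 19, 22, 21, 13, 14, 5, 4, 6, 7, 0, 1, 11, 10, 8, 9, 3, 2],
    ![16, 19, 23, 20, 13, 14, 12, 15, 22, 21, 17, 18, 6, 4, 5, 7, 0, 10, 11, 1, 3, 9, 8, 2],
    ![22, 21, 17, 18, 13, 14, 12, 15, 16, 19, 23, 20, 7, 4, 5, 6, 0, 11, 10, 1, 2, 9, 8, 3],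
    ![16, 18, 22, 20, 13, 15, 12, 14, 23, 21, 17, 19, 8, 2, 3, 9, 0, 10, 11, 1, 5, 7, 6, 4],
    ![23, 21, 17, 19, 13, 15, 12, 14, 16, 18, 22, 20, 9, 2, 3, 8, 0, 11, 10, 1, 4, 7, 6, 5],
    ![16, 17, 21, 20, 14, 15, 12, 13, 23, 22, 18, 19, 10, 0, 1, 11, 2, 8, 9, 3, 5, 7, 6, 4],
    ![23, 22, 18, 19, 14, 15, 12, 13, 16, 17, 21, 20, 11, 0, 1, 10, 2, 9, 8, 3, 4, 7, 6, 5],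
    ![0, 1, 2, 3, 4, 5, 6, 7, 8, 9, 10, 11, 12, 13, 14, 15, 16, 17, 18, 19, 20, 21, 22, 23],
    ![0, 1, 6, 7, 8, 9, 2, 3, 4, 5, 10, 11, 13, 12, 14, 15, 16, 17, 19, 18, 21, 20, 22, 23],
    ![2, 3, 6, 7, 10, 11, 0, 1, 4, 5, 8, 9, 14, 12, 13, 15, 16, 18, 19, 17, 22, 20, 21, 23],
    ![4, 5, 8, 9, 10, 11, 0, 1, 2, 3, 6, 7, 15, 12, 13, 14, 16, 19, 18, 17, 23, 20, 21, 22],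
    ![0, 10, 2, 8, 4, 6, 5, 7, 3, 9, 1, 11, 16, 17, 18, 19, 12, 13, 14, 15, 20, 21, 22, 23],
    ![0, 10, 5, 7, 3, 9, 2, 8, 4, 6, 1, 11, 17, 16, 18, 19, 12, 13, 15, 14, 21, 20, 22, 23],
    ![2, 8, 5, 7, 1, 11, 0, 10, 4, 6, 3, 9, 18, 16, 17, 19, 12, 14, 15, 13, 22, 20, 21, 23],
    ![4, 6, 3, 9, 1, 11, 0, 10, 2, 8, 5, 7, 19, 16, 17, 18, 12, 15, 14, 13, 23, 20, 21, 22],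
    ![10, 1, 8, 3, 6, 5, 4, 7, 2, 9, 0, 11, 20, 21, 22, 23, 16, 17, 18, 19, 12, 13, 14, 15],
    ![10, 1, 4, 7, 2, 9, 8, 3, 6, 5, 0, 11, 21, 20, 22, 23, 16, 17, 19, 18, 13, 12, 14, 15],
    ![8, 3, 4, 7, 0, 11, 10, 1, 6, 5, 2, 9, 22, 20, 21, 23, 16, 18, 19, 17, 14, 12, 13, 15],
    ![6, 5, 2, 9, 0, 11, 10, 1, 8, 3, 4, 7, 23, 20, 21, 22, 16, 19, 18, 17, 15, 12, 13, 14]]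

/-- Weights of the standard inequality. -/
def w4 : Fin 24 → ℕ :=
  ![0, 0, 0, 0, 0, 0, 8, 8, 8, 8, 8, 8, 12, 4, 4, 4, 3, 3, 3, 3, 3, 3, 3, 3]

/-- The matrix of a frame. -/
def Af (j : Fin 24) (i k : Fin 4) : ℤ := PZ (fr j k) i

theorem Af_sg : ∀ j n, ∃ c ∈ [(1 : ℤ), -1, 2, -2, 4, -4],
    ∀ i, ∑ k, Af j i k * PZ n k = c * PZ (sg j n) i := by decide +kernel

theorem Af_orth : ∀ j, ∃ s ∈ [(1 : ℤ), 2, 4],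
    ∀ i i', ∑ k, Af j i k * Af j i' k = if i = i' then s else 0 := by decide +kernel

theorem sg_surj : ∀ j k, ∃ n, sg j n = k := by decide +kernel

theorem w4_sum : ∀ k, ∑ j, ∑ n, (if sg j n = k then w4 n else 0) = 96 := by decide +kernel

/-- Linear substitution. -/
noncomputable def sub {a b : ℕ} (E : Fin a → Fin b → ℤ) (F : MvPolynomial (Fin a) ℂ) :
    MvPolynomial (Fin b) ℂ := aeval (fun i => lin (cv (E i))) F

theorem sub_eval {a b : ℕ} (E : Fin a → Fin b → ℤ) (F : MvPolynomial (Fin a) ℂ) (x : Fin b → ℂ) :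
    eval x (sub E F) = eval (fun i => ∑ l, (E i l : ℂ) * x l) F := by
  rw [sub, eval_aeval_s8]
  simp only [lin_eval, cv]

theorem sub_hom {a b : ℕ} (E : Fin a → Fin b → ℤ) (F : MvPolynomial (Fin a) ℂ) (d : ℕ)
    (hF : F.IsHomogeneous d) : (sub E F).IsHomogeneous d := by
  have := hF.aeval (fun i => lin (cv (E i))) (n := 1) (fun i => lin_hom _)
  rwa [one_mul] at this

theorem sub_DV {a b : ℕ} (E : Fin a → Fin b → ℤ) (F : MvPolynomial (Fin a) ℂ) (d : ℕ)
    (hF : F.IsHomogeneous d) (v : Fin b → ℤ) (v' : Fin a → ℤ) (c : ℤ)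
    (h : ∀ i, ∑ l, E i l * v l = c * v' i) (m : ℕ) (hm : DV (cv v') m F) :
    DV (cv v) m (sub E F) := by
  refine DV_comp _ (fun i => cv (E i)) (fun i j => lin_pderiv _ _) _ _ _ ?_
  have e : (fun i => eval (cv v) (lin (cv (E i)))) = (c : ℂ) • cv v' := by
    ext i
    rw [lin_eval]
    simp only [cv, Pi.smul_apply, smul_eq_mul]
    exact_mod_cast h i
  rw [e]
  exact DV_smul _ _ _ _ _ hF hm

/-- The embedding of the plane orthogonal to the first point. -/
def Em : Fin 4 → Fin 3 → ℤ := ![![0, 0, 0], ![1, 0, 0], ![0, 1, 0], ![0, 0, 1]]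

/-- The thirteen points of the plane, in space. -/
def QE (n : Fin 13) : Fin 4 → ℤ := ![0, Q n 0, Q n 1, Q n 2]

theorem QE_eq : ∀ n, ∀ i, ∑ l, Em i l * Q n l = 1 * QE n i := by decide

theorem mult_pt (F : MvPolynomial (Fin 4) ℂ) (d : ℕ) (hF : F.IsHomogeneous d)
    (m : Fin 24 → ℕ) (hm : ∀ n, DV (cv (PZ n)) (m n) F) (q : Fin 4 → ℤ) (a b : Fin 24)
    (ca cb : ℤ) (ha : PZ 12 + q = ca • PZ a) (hb : PZ 12 - q = cb • PZ b) :
    DV (cv q) ((m 12 + m a + m b + 1 - d) / 2) F := by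
  have hs : ∀ (c : ℤ) (z : Fin 4 → ℤ), cv (c • z) = (c : ℂ) • cv z := by
    intro c z; ext i; simp [cv]
  have h3 : DV (cv (PZ 12) + cv q) (m a) F := by
    have e : cv (PZ 12) + cv q = (ca : ℂ) • cv (PZ a) := by
      rw [← hs, ← ha]; ext i; simp [cv]
    rw [e]; exact DV_smul _ _ _ _ _ hF (hm a)
  have h4 : DV (cv (PZ 12) - cv q) (m b) F := by
    have e : cv (PZ 12) - cv q = (cb : ℂ) • cv (PZ b) := by
      rw [← hs, ← hb]; ext i; simp [cv]
    rw [e]; exact DV_smul _ _ _ _ _ hF (hm b)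
  by_cases h0 : (m 12 + m a + m b + 1 - d) / 2 = 0
  · rw [h0]; trivial
  · exact mult_line _ _ _ F d _ _ _ hF (hm 12) h3 h4 (by omega)

set_option maxHeartbeats 2000000 in
theorem std_ineq (F : MvPolynomial (Fin 4) ℂ) (d : ℕ) (hF : F.IsHomogeneous d)
    (hdvd : ¬ lin (cv ![1, 0, 0, 0]) ∣ F)
    (m : Fin 24 → ℕ) (hm : ∀ n, DV (cv (PZ n)) (m n) F) :
    ∑ n, w4 n * m n ≤ 36 * d := by
  have hG0 : sub Em F ≠ 0 := by
    intro h0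
    refine hdvd (lin_dvd _ 0 (by simp [cv]) _ fun x hx => ?_)
    have hx0 : x 0 = 0 := by
      rw [lin_eval] at hx
      simpa [cv, Fin.sum_univ_four] using hx
    have := sub_eval Em F ![x 1, x 2, x 3]
    rw [h0, map_zero] at this
    rw [this]
    congr 1
    congr 1
    ext i
    fin_cases i <;> simp [Em, Fin.sum_univ_three, hx0]
  have h1 := mult_pt F d hF m hm (QE 9) 16 20 1 (-1) (by decide) (by decide)
  have h2 := mult_pt F d hF m hm (QE 10) 23 19 1 1 (by decide) (by decide)
  have h3 := mult_pt F d hF m hm (QE 11) 22 18 1 1 (by decide) (by decide)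
  have h4 := mult_pt F d hF m hm (QE 12) 17 21 1 1 (by decide) (by decide)
  have hp := plane_bound d (sub Em F) hG0 (sub_hom _ _ _ hF)
    ![m 6, m 7, m 8, m 9, m 10, m 11, m 13, m 14, m 15,
      (m 12 + m 16 + m 20 + 1 - d) / 2, (m 12 + m 23 + m 19 + 1 - d) / 2,
      (m 12 + m 22 + m 18 + 1 - d) / 2, (m 12 + m 17 + m 21 + 1 - d) / 2] (by
    intro n
    refine sub_DV Em F d hF (Q n) (QE n) 1 (QE_eq n) _ ?_
    have hq : ∀ (n : Fin 13) (k : Fin 24), QE n = PZ k → DV (cv (QE n)) (m k) F := by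
      intro n k h; rw [h]; exact hm k
    fin_cases n
    · exact hq 0 6 (by decide)
    · exact hq 1 7 (by decide)
    · exact hq 2 8 (by decide)
    · exact hq 3 9 (by decide)
    · exact hq 4 10 (by decide)
    · exact hq 5 11 (by decide)
    · exact hq 6 13 (by decide)
    · exact hq 7 14 (by decide)
    · exact hq 8 15 (by decide)
    · exact h1
    · exact h2
    · exact h3
    · exact h4)
  simp only [Fin.sum_univ_succ, Qw, w4] at hp ⊢
  simp [Fin.succ] at hp ⊢
  omega

theorem sub_ne (j : Fin 24) (F : MvPolynomial (Fin 4) ℂ) (hF : F ≠ 0) : sub (Af j) F ≠ 0 := by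
  intro h0
  refine hF (MvPolynomial.funext fun x => ?_)
  obtain ⟨s, hs, h⟩ := Af_orth j
  have hs0 : (s : ℂ) ≠ 0 := by
    have : s ≠ 0 := by
      rintro rfl
      revert hs
      decide
    exact_mod_cast this
  have := sub_eval (Af j) F (fun k => (∑ i, (Af j i k : ℂ) * x i) / s)
  rw [h0, map_zero] at this
  rw [map_zero, this]
  congr 2
  ext i
  have h' : ∀ i', ∑ k, (Af j i k : ℂ) * (Af j i' k : ℂ) = if i = i' then (s : ℂ) else 0 := by
    intro i'
    exact_mod_cast h i i'
  have e : ∑ l, (Af j i l : ℂ) * ((∑ i', (Af j i' l : ℂ) * x i') / s)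
      = (∑ i', (∑ k, (Af j i k : ℂ) * (Af j i' k : ℂ)) * x i') / s := by
    simp only [Finset.sum_mul, Finset.mul_sum, Finset.sum_div, mul_div_assoc]
    rw [Finset.sum_comm]
    refine Finset.sum_congr rfl fun _ _ => Finset.sum_congr rfl fun _ _ => ?_
    ring
  rw [e]
  simp only [h']
  simp
  field_simp

theorem main_bound (d : ℕ) : ∀ (F : MvPolynomial (Fin 4) ℂ), F ≠ 0 → F.IsHomogeneous d →
    ∀ m : Fin 24 → ℕ, (∀ n, DV (cv (PZ n)) (m n) F) → ∑ n, m n ≤ 9 * d := by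
  induction d using Nat.strong_induction_on with
  | _ d ih =>
    intro F hF0 hF m hm
    have hm' : ∀ j n, DV (cv (PZ n)) (m (sg j n)) (sub (Af j) F) := by
      intro j n
      obtain ⟨c, -, hc⟩ := Af_sg j n
      exact sub_DV (Af j) F d hF _ _ c hc _ (hm _)
    by_cases h : ∃ j, lin (cv ![1, 0, 0, 0]) ∣ sub (Af j) F
    · obtain ⟨j, hj⟩ := h
      obtain ⟨G, d', m', hd, hG0, hG, hGm, hle⟩ := remove PZ ![1, 0, 0, 0] 0 (by decide)
        (fun _ => 1) 9 (by decide) (sub (Af j) F) d (sub_ne j F hF0) (sub_hom _ _ _ hF)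
        (fun n => m (sg j n)) (hm' j) hj
      have h1 := ih d' (by omega) G hG0 hG m' hGm
      have hb : Function.Bijective (sg j) := Finite.surjective_iff_bijective.mp (sg_surj j)
      have h2 : ∑ n, m (sg j n) = ∑ n, m n := hb.sum_comp m
      simp only [one_mul] at hle
      omega
    · push Not at h
      have h1 : ∀ j, ∑ n, w4 n * m (sg j n) ≤ 36 * d := fun j =>
        std_ineq _ d (sub_hom _ _ _ hF) (h j) _ (hm' j)
      have h2 : ∑ j, ∑ n, w4 n * m (sg j n) ≤ ∑ _j : Fin 24, 36 * d :=
        Finset.sum_le_sum fun j _ => h1 j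
      have h3 : ∑ j, ∑ n, w4 n * m (sg j n) = ∑ k, 96 * m k := by
        have e : ∀ k, 96 * m k = ∑ j, ∑ n, (if sg j n = k then w4 n else 0) * m k := by
          intro k
          rw [← w4_sum k, Finset.sum_mul]
          exact Finset.sum_congr rfl fun _ _ => Finset.sum_mul _ _ _
        simp only [e]
        rw [Finset.sum_comm (s := (Finset.univ : Finset (Fin 24)))
          (f := fun k j => ∑ n, (if sg j n = k then w4 n else 0) * m k)]
        refine Finset.sum_congr rfl fun j _ => ?_
        rw [Finset.sum_comm (f := fun k n => (if sg j n = k then w4 n else 0) * m k)]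
        refine Finset.sum_congr rfl fun n _ => ?_
        simp
      rw [h3, ← Finset.mul_sum] at h2
      simp at h2
      omega

/-- For every odd positive integer `p`, every nonzero homogeneous polynomial vanishing
to order at least `18p` at each point of the F4 configuration has degree at least `48p`. -/
theorem F4_alpha_lower_bound (p : ℕ) (hp : 1 ≤ p) (hodd : Odd p)
    (F : MvPolynomial (Fin 4) ℂ) (d : ℕ) (hF : F ≠ 0) (hhom : F.IsHomogeneous d)
    (hvan : ∀ n : Fin 24, vanishesToOrder F (F4Pts n) (18 * p)) :
    48 * p ≤ d := by
  have h := main_bound d F hF hhom (fun _ => 18 * p) (fun n => by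
    rw [← F4Pts_eq_s8]
    exact DV_of_vanishes _ _ _ (hvan n))
  simp at h
  omega
end
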